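/- arXiv:1008.0809 — 4 statements merged into one kernel-verified Lean document; each statement's English description precedes it below -/
import Mathlib

section
/- Assume there exists a subset A ⊆ ℤ which is Diophantine over ℤ but not computable. If there exist k ∈ ℕ and an injective map φ : ℤ → ℚ^k such that the sets {(φ(a), φ(b), φ(a+b)) : a, b ∈ ℤ} and {(φ(a), φ(b), φ(a·b)) : a, b ∈ ℤ} are Diophantine subsets of ℚ^{3k}, then there exists a Diophantine subset of ℚ^k that is not computable (with respect to the standard encoding of tuples of rationals). -/
/-- A subset `A ⊆ R^ι` (for a finite index type `ι`) is *Diophantine* over a commutative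
ring `R` if there are `k ∈ ℕ` and a polynomial `p` with coefficients in `R` such that a
tuple `t` lies in `A` iff `p(t, x) = 0` has a solution `x ∈ R^k`. -/
def IsDiophantine (R : Type*) [CommRing R] (ι : Type) [Fintype ι] (A : Set (ι → R)) : Prop :=
  ∃ (k : ℕ) (p : MvPolynomial (ι ⊕ Fin k) R),
    ∀ t : ι → R, t ∈ A ↔ ∃ x : Fin k → R, MvPolynomial.eval (Sum.elim t x) p = 0

theorem primrecPred_coprime_pos :
    PrimrecPred fun m : ℕ × ℕ => 0 < m.2 ∧ Nat.Coprime m.1 m.2 := by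
  have hdvd : PrimrecRel fun x y : ℕ => y % x = 0 :=
    PrimrecRel.comp Primrec.eq (Primrec.nat_mod.comp Primrec.snd Primrec.fst) (Primrec.const 0)
  have hR : PrimrecRel fun (x : ℕ) (m : ℕ × ℕ) => ¬ (m.1 % x = 0 ∧ m.2 % x = 0) ∨ x = 1 :=
    PrimrecPred.or
      (PrimrecPred.not <| PrimrecPred.and
        (hdvd.comp Primrec.fst (Primrec.fst.comp Primrec.snd))
        (hdvd.comp Primrec.fst (Primrec.snd.comp Primrec.snd)))
      (PrimrecRel.comp Primrec.eq Primrec.fst (Primrec.const 1))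
  refine (PrimrecPred.and
    (PrimrecRel.comp Primrec.nat_lt (Primrec.const 0) Primrec.snd)
    (hR.forall_mem_list.comp (Primrec.list_range.comp (Primrec.succ.comp Primrec.snd))
      Primrec.id)).of_eq fun m => ?_
  refine and_congr_right fun hm => ⟨fun h => ?_, fun h x _ => ?_⟩
  · refine ((h (Nat.gcd m.1 m.2)
      (List.mem_range.2 (Nat.lt_succ_of_le (Nat.gcd_le_right _ hm)))).resolve_left
        fun h' => h' ⟨?_, ?_⟩)
    · exact Nat.mod_eq_zero_of_dvd (Nat.gcd_dvd_left _ _)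
    · exact Nat.mod_eq_zero_of_dvd (Nat.gcd_dvd_right _ _)
  · refine or_iff_not_imp_left.2 fun h' => ?_
    rw [not_not] at h'
    exact Nat.eq_one_of_dvd_coprimes h (Nat.dvd_of_mod_eq_zero h'.1) (Nat.dvd_of_mod_eq_zero h'.2)

theorem encode_int_nonneg (n : ℕ) : Encodable.encode (n : ℤ) = 2 * n := rfl
theorem encode_int_negSucc (n : ℕ) : Encodable.encode (Int.negSucc n) = 2 * n + 1 := rfl

theorem Primrec.int_toNat : Primrec Int.toNat := by
  refine (Primrec.ite (PrimrecRel.comp Primrec.eq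
    (Primrec.nat_mod.comp Primrec.encode (Primrec.const 2)) (Primrec.const 0))
    (Primrec.nat_div.comp Primrec.encode (Primrec.const 2)) (Primrec.const 0)).of_eq fun z => ?_
  rcases z with n | n
  · rw [Int.ofNat_eq_natCast, encode_int_nonneg]; simp
  · rw [encode_int_negSucc]; simp [Nat.add_mod]

theorem Primrec.int_neg_toNat : Primrec fun z : ℤ => (-z).toNat := by
  refine (Primrec.ite (PrimrecRel.comp Primrec.eq
    (Primrec.nat_mod.comp Primrec.encode (Primrec.const 2)) (Primrec.const 0))
    (Primrec.const 0) (Primrec.succ.comp <|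
      Primrec.nat_div.comp Primrec.encode (Primrec.const 2))).of_eq fun z => ?_
  rcases z with n | n
  · rw [Int.ofNat_eq_natCast, encode_int_nonneg]; simp
  · rw [encode_int_negSucc]; simp [Nat.add_mod, Int.neg_negSucc]; omega

theorem Rat.encode_eq_pair (q : ℚ) :
    @Encodable.encode ℚ Rat.instEncodable q = Nat.pair (Encodable.encode q.num) q.den := rfl

theorem Rat.mem_range_encode_iff (m : ℕ) :
    m ∈ Set.range (@Encodable.encode ℚ Rat.instEncodable) ↔
      0 < m.unpair.2 ∧ Nat.Coprime ((m.unpair.1 + 1) / 2) m.unpair.2 := by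
  have key (z : ℤ) : (Encodable.encode z + 1) / 2 = z.natAbs := by
    rcases z with n | n
    · rw [Int.ofNat_eq_natCast, encode_int_nonneg]; simp; omega
    · rw [encode_int_negSucc]; simp; omega
  constructor
  · rintro ⟨q, rfl⟩
    rw [Rat.encode_eq_pair, Nat.unpair_pair, key]
    exact ⟨q.pos, q.reduced⟩
  · rintro ⟨h0, h⟩
    obtain ⟨z, hz⟩ := (Denumerable.eqv ℤ).surjective m.unpair.1
    replace hz : Encodable.encode z = m.unpair.1 := hz
    rw [← hz, key] at h
    refine ⟨⟨z, m.unpair.2, h0.ne', h⟩, ?_⟩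
    rw [Rat.encode_eq_pair]
    simp only [hz, Nat.pair_unpair]

theorem computable_coe_subtype_ofNat {s : Set ℕ} [DecidablePred (· ∈ s)] [Infinite s]
    (hs : ComputablePred (· ∈ s)) : Computable fun n => (Nat.Subtype.ofNat s n : ℕ) := by
  have hex (m : ℕ) : ∃ n, m < n ∧ n ∈ s := by
    obtain ⟨n, hn, hmn⟩ := (Set.infinite_coe_iff.1 ‹Infinite s›).exists_gt m
    exact ⟨n, hmn, hn⟩
  classical
  have hfind : Computable fun m => Nat.find (hex m) := by
    refine Computable.find (P := fun m n => m < n ∧ n ∈ s) ?_ hex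
    refine Computable.computablePred ?_
    refine (Primrec.and.to_comp.comp (Primrec.nat_lt.decide.to_comp)
      (hs.decide.comp Computable.snd)).of_eq fun p => ?_
    simp
  refine (Computable.nat_rec (f := id) (h := fun _ p => Nat.find (hex p.2)) Computable.id
    (Computable.const ((⊥ : s) : ℕ))
    (hfind.comp (Computable.snd.comp Computable.snd)).to₂).of_eq fun n => ?_
  induction n with
  | zero => rfl
  | succ n ih =>
    simp only [id] at ih ⊢
    rw [ih, Nat.find_eq_iff]
    refine ⟨⟨Nat.Subtype.lt_succ_self _, Subtype.prop _⟩, fun m hm h => ?_⟩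
    exact (Nat.Subtype.succ_le_of_lt (x := ⟨m, h.2⟩) (y := Nat.Subtype.ofNat s n) h.1).not_gt hm

theorem encode_ofNat_ofEncodableOfInfinite (α : Type*) [Encodable α] [Infinite α] (n : ℕ) :
    letI := Encodable.decidableRangeEncode α
    letI : Infinite (Set.range (@Encodable.encode α _)) :=
      Infinite.of_injective _ (Equiv.ofInjective _ Encodable.encode_injective).injective
    Encodable.encode (@Denumerable.ofNat α (Denumerable.ofEncodableOfInfinite α) n) =
      Nat.Subtype.ofNat (Set.range (@Encodable.encode α _)) n := by
  let := Encodable.decidableRangeEncode α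
  let : Infinite (Set.range (@Encodable.encode α _)) :=
    Infinite.of_injective _ (Equiv.ofInjective _ Encodable.encode_injective).injective
  let := Nat.Subtype.denumerable (Set.range (@Encodable.encode α _))
  have h := Denumerable.ofEquiv_ofNat (Set.range (@Encodable.encode α _))
    (Encodable.equivRangeEncode α) n
  have h' : Denumerable.ofNat (Set.range (@Encodable.encode α _)) n =
    Nat.Subtype.ofNat (Set.range (@Encodable.encode α _)) n :=
    Denumerable.ofEquiv_ofNat ℕ _ n
  rw [h'] at h
  have h2 := congrArg (Encodable.equivRangeEncode α) h
  rw [Equiv.apply_symm_apply] at h2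
  exact congrArg Subtype.val h2

theorem Rat.computable_encode :
    Computable (@Encodable.encode ℚ Rat.instEncodable) := by
  let := @Encodable.decidableRangeEncode ℚ Rat.instEncodable
  let : Infinite (Set.range (@Encodable.encode ℚ Rat.instEncodable)) :=
    Infinite.of_injective _
      (Equiv.ofInjective _ (@Encodable.encode_injective ℚ Rat.instEncodable)).injective
  have hs : ComputablePred (· ∈ Set.range (@Encodable.encode ℚ Rat.instEncodable)) := by
    refine (PrimrecPred.of_eq (primrecPred_coprime_pos.comp (f := fun m : ℕ =>
      ((m.unpair.1 + 1) / 2, m.unpair.2)) ?_)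
      fun m => (Rat.mem_range_encode_iff m).symm).computablePred
    exact Primrec.pair (Primrec.nat_div.comp (Primrec.succ.comp (Primrec.fst.comp Primrec.unpair))
      (Primrec.const 2)) (Primrec.snd.comp Primrec.unpair)
  refine ((computable_coe_subtype_ofNat hs).comp Computable.encode).of_eq fun q => ?_
  have h (n : ℕ) : @Encodable.encode ℚ Rat.instEncodable (Denumerable.ofNat ℚ n) =
      Nat.Subtype.ofNat (Set.range (@Encodable.encode ℚ Rat.instEncodable)) n :=
    @encode_ofNat_ofEncodableOfInfinite ℚ Rat.instEncodable _ n
  rw [← h]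
  exact congrArg _ (Denumerable.ofNat_encode q)

theorem Rat.computable_num : Computable Rat.num := by
  refine ((Computable.ofNat ℤ).comp (Computable.fst.comp
    (Computable.unpair.comp Rat.computable_encode))).of_eq fun q => ?_
  rw [Rat.encode_eq_pair, Nat.unpair_pair, Denumerable.ofNat_encode]

theorem Rat.computable_den : Computable Rat.den := by
  refine (Computable.snd.comp (Computable.unpair.comp Rat.computable_encode)).of_eq fun q => ?_
  rw [Rat.encode_eq_pair, Nat.unpair_pair]

theorem ComputablePred.eq_comp {α β : Type*} [Primcodable α] [Primcodable β] {f g : α → β}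
    (hf : Computable f) (hg : Computable g) : ComputablePred fun a => f a = g a := by
  classical
  refine Computable.computablePred ?_
  exact (Primrec.eq (α := β)).decide.to_comp.comp hf hg

/-- Searching for a witness of a computable relation is a partial recursive procedure. -/
theorem ComputablePred.exists_partrec_search {α β γ : Type*} [Primcodable α] [Primcodable β]
    [Primcodable γ] {P : α → β → Prop} (hP : ComputablePred fun p : α × β => P p.1 p.2)
    {g : β → γ} (hg : Computable g) :
    ∃ G : α →. γ, Partrec G ∧
      ∀ a c, (∃ b, P a b) → (∀ b, P a b → g b = c) → G a = Part.some c := by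
  obtain ⟨d, hd, hdP⟩ := ComputablePred.computable_iff.1 hP
  let F : α → ℕ → Option γ := fun a n =>
    (Encodable.decode (α := β) n).bind fun b => bif d (a, b) then some (g b) else Option.none
  have hF : Computable₂ F := by
    have hc : Computable fun q : (α × ℕ) × β => d (q.1.1, q.2) :=
      hd.comp (Computable.pair (Computable.fst.comp Computable.fst) Computable.snd)
    have hs : Computable fun q : (α × ℕ) × β => some (g q.2) :=
      Computable.option_some.comp (hg.comp Computable.snd)
    exact Computable.option_bind (Computable.decode.comp Computable.snd)
      (Computable.cond hc hs (Computable.const Option.none)).to₂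
  have memF (a : α) (n : ℕ) (c : γ) : c ∈ F a n ↔
      ∃ b, Encodable.decode (α := β) n = some b ∧ P a b ∧ g b = c := by
    simp only [F, Option.mem_def, Option.bind_eq_some_iff]
    refine exists_congr fun b => and_congr_right fun _ => ?_
    rw [iff_of_eq (congrFun hdP (a, b))]
    cases d (a, b) <;> simp
  refine ⟨fun a => Nat.rfindOpt (F a), Partrec.rfindOpt hF, fun a c ⟨b, hb⟩ hc => ?_⟩
  have hdom : (Nat.rfindOpt (F a)).Dom := Nat.rfindOpt_dom.2
    ⟨Encodable.encode b, g b, (memF _ _ _).2 ⟨b, Encodable.encodek b, hb, rfl⟩⟩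
  refine Part.eq_some_iff.2 ?_
  obtain ⟨n, hn⟩ := Nat.rfindOpt_spec (Part.get_mem hdom)
  obtain ⟨b', -, hb', h⟩ := (memF _ _ _).1 hn
  rw [← hc b' hb', h]
  exact Part.get_mem hdom

theorem Computable.of_computablePred_graph {α β : Type*} [Primcodable α] [Primcodable β]
    {f : α → β} (h : ComputablePred fun p : α × β => f p.1 = p.2) : Computable f := by
  obtain ⟨G, hG, hGs⟩ := ComputablePred.exists_partrec_search
      (P := fun a b => f a = b) h Computable.id
  exact hG.of_eq_tot fun a => Part.eq_some_iff.1 (hGs a (f a) ⟨_, rfl⟩ fun b hb => hb.symm)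

theorem Rat.mul_den_eq_toNat_sub (q : ℚ) :
    q * q.den = (q.num.toNat : ℚ) - ((-q.num).toNat : ℚ) := by
  rw [Rat.mul_den_eq_num]
  exact_mod_cast (Int.toNat_sub_toNat_neg q.num).symm

section

variable {α : Type*} [Primcodable α]

theorem Computable.rat_num_toNat {f : α → ℚ} (hf : Computable f) :
    Computable fun a => (f a).num.toNat :=
  Primrec.int_toNat.to_comp.comp (Rat.computable_num.comp hf)

theorem Computable.rat_neg_num_toNat {f : α → ℚ} (hf : Computable f) :
    Computable fun a => (-(f a).num).toNat :=
  Primrec.int_neg_toNat.to_comp.comp (Rat.computable_num.comp hf)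

theorem Computable.rat_den {f : α → ℚ} (hf : Computable f) : Computable fun a => (f a).den :=
  Rat.computable_den.comp hf

theorem Computable.nat_add {f g : α → ℕ} (hf : Computable f) (hg : Computable g) :
    Computable fun a => f a + g a :=
  Primrec.nat_add.to_comp.comp hf hg

theorem Computable.nat_mul {f g : α → ℕ} (hf : Computable f) (hg : Computable g) :
    Computable fun a => f a * g a :=
  Primrec.nat_mul.to_comp.comp hf hg

end

theorem Rat.computable_add : Computable₂ ((· + ·) : ℚ → ℚ → ℚ) := by
  refine Computable.of_computablePred_graph ?_
  have h1 : Computable fun p : (ℚ × ℚ) × ℚ => p.1.1 := Computable.fst.comp Computable.fst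
  have h2 : Computable fun p : (ℚ × ℚ) × ℚ => p.1.2 := Computable.snd.comp Computable.fst
  have h3 : Computable fun p : (ℚ × ℚ) × ℚ => p.2 := Computable.snd
  have h12 := h1.rat_den.nat_mul h2.rat_den
  have h13 := h1.rat_den.nat_mul h3.rat_den
  have h23 := h2.rat_den.nat_mul h3.rat_den
  refine (ComputablePred.eq_comp
    (((h1.rat_num_toNat.nat_mul h23).nat_add (h2.rat_num_toNat.nat_mul h13)).nat_add
      (h3.rat_neg_num_toNat.nat_mul h12))
    (((h1.rat_neg_num_toNat.nat_mul h23).nat_add (h2.rat_neg_num_toNat.nat_mul h13)).nat_add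
      (h3.rat_num_toNat.nat_mul h12))).of_eq ?_
  rintro ⟨⟨a, b⟩, c⟩
  have ha : (a.den : ℚ) ≠ 0 := by exact_mod_cast a.den_nz
  have hb : (b.den : ℚ) ≠ 0 := by exact_mod_cast b.den_nz
  have hc : (c.den : ℚ) ≠ 0 := by exact_mod_cast c.den_nz
  have ea := a.mul_den_eq_toNat_sub
  have eb := b.mul_den_eq_toNat_sub
  have ec := c.mul_den_eq_toNat_sub
  change _ ↔ a + b = c
  rw [← Nat.cast_inj (R := ℚ),
    ← mul_left_inj' (a := a + b) (b := c) (mul_ne_zero (mul_ne_zero ha hb) hc)]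
  push_cast
  constructor <;> intro h
  · linear_combination h + b.den * c.den * ea + a.den * c.den * eb - a.den * b.den * ec
  · linear_combination h - b.den * c.den * ea - a.den * c.den * eb + a.den * b.den * ec

theorem Rat.computable_mul : Computable₂ ((· * ·) : ℚ → ℚ → ℚ) := by
  refine Computable.of_computablePred_graph ?_
  have h1 : Computable fun p : (ℚ × ℚ) × ℚ => p.1.1 := Computable.fst.comp Computable.fst
  have h2 : Computable fun p : (ℚ × ℚ) × ℚ => p.1.2 := Computable.snd.comp Computable.fst
  have h3 : Computable fun p : (ℚ × ℚ) × ℚ => p.2 := Computable.snd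
  have h12 := h1.rat_den.nat_mul h2.rat_den
  refine (ComputablePred.eq_comp
    ((((h1.rat_num_toNat.nat_mul h2.rat_num_toNat).nat_add
      (h1.rat_neg_num_toNat.nat_mul h2.rat_neg_num_toNat)).nat_mul h3.rat_den).nat_add
      (h3.rat_neg_num_toNat.nat_mul h12))
    ((((h1.rat_num_toNat.nat_mul h2.rat_neg_num_toNat).nat_add
      (h1.rat_neg_num_toNat.nat_mul h2.rat_num_toNat)).nat_mul h3.rat_den).nat_add
      (h3.rat_num_toNat.nat_mul h12))).of_eq ?_
  rintro ⟨⟨a, b⟩, c⟩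
  have ha : (a.den : ℚ) ≠ 0 := by exact_mod_cast a.den_nz
  have hb : (b.den : ℚ) ≠ 0 := by exact_mod_cast b.den_nz
  have hc : (c.den : ℚ) ≠ 0 := by exact_mod_cast c.den_nz
  have ea := a.mul_den_eq_toNat_sub
  have eb := b.mul_den_eq_toNat_sub
  have ec := c.mul_den_eq_toNat_sub
  have eab := congrArg₂ (· * ·) ea eb
  change _ ↔ a * b = c
  rw [← Nat.cast_inj (R := ℚ),
    ← mul_left_inj' (a := a * b) (b := c) (mul_ne_zero (mul_ne_zero ha hb) hc)]
  push_cast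
  constructor <;> intro h
  · linear_combination h + c.den * eab - a.den * b.den * ec
  · linear_combination h - c.den * eab + a.den * b.den * ec

theorem MvPolynomial.computable_eval_rat {α σ : Type*} [Primcodable α] {v : α → σ → ℚ}
    (hv : ∀ i, Computable fun a => v a i) (p : MvPolynomial σ ℚ) :
    Computable fun a => MvPolynomial.eval (v a) p := by
  induction p using MvPolynomial.induction_on with
  | C c => simpa using Computable.const c
  | add p q hp hq => simpa using Rat.computable_add.comp hp hq
  | mul_X p i hp => simpa using Rat.computable_mul.comp hp (hv i)

theorem Computable.finFun_apply {α β : Type*} [Primcodable α] [Primcodable β] {n : ℕ}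
    {f : α → Fin n → β} (hf : Computable f) (i : Fin n) : Computable fun a => f a i :=
  Computable.fin_app.comp hf (Computable.const i)

/-- A map from `ℤ` to `ℚ^k` for which the graph of addition is Diophantine is computable. -/
theorem computable_of_isDiophantine_add {k : ℕ} {φ : ℤ → (Fin k → ℚ)}
    (hφ : Function.Injective φ)
    (hadd : IsDiophantine ℚ (Fin 3 × Fin k)
      {t | ∃ a b : ℤ, (∀ i, t (0, i) = φ a i) ∧ (∀ i, t (1, i) = φ b i) ∧
        ∀ i, t (2, i) = φ (a + b) i}) : Computable φ := by
  obtain ⟨m, p, hp⟩ := hadd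
  have hmul (c : ℤ) : Computable fun n : ℕ => φ (n * c) := by
    let v : (Fin k → ℚ) × (Fin k → ℚ) × (Fin m → ℚ) → (Fin 3 × Fin k) ⊕ Fin m → ℚ :=
      fun q => Sum.elim (fun i => ![q.1, φ c, q.2.1] i.1 i.2) q.2.2
    have hv (i) : Computable fun q => v q i := by
      rcases i with ⟨j, i⟩ | i
      · fin_cases j
        · exact Computable.fst.finFun_apply i
        · exact Computable.const (φ c i)
        · exact (Computable.fst.comp Computable.snd).finFun_apply i
      · exact (Computable.snd.comp Computable.snd).finFun_apply i
    obtain ⟨G, hG, hGs⟩ := ComputablePred.exists_partrec_search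
      (P := fun s b => MvPolynomial.eval (v (s, b)) p = 0)
      (ComputablePred.eq_comp (MvPolynomial.computable_eval_rat hv p) (Computable.const 0))
      (Computable.fst)
    have hstep (n : ℕ) : G (φ (n * c)) = Part.some (φ ((n + 1 : ℕ) * c)) := by
      apply hGs
      · obtain ⟨x, hx⟩ := (hp fun i => ![φ (n * c), φ c, φ ((n + 1 : ℕ) * c)] i.1 i.2).1
          ⟨n * c, c, fun i => rfl, fun i => rfl, fun i => by rw [Nat.cast_succ, add_one_mul]; rfl⟩
        exact ⟨(_, x), hx⟩
      · rintro ⟨t, x⟩ h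
        obtain ⟨a, b, h0, h1, h2⟩ := (hp fun i => ![φ (n * c), φ c, t] i.1 i.2).2 ⟨x, h⟩
        obtain rfl : (n * c : ℤ) = a := hφ (funext h0)
        obtain rfl : c = b := hφ (funext h1)
        rw [Nat.cast_succ, add_one_mul]
        exact funext h2
    refine Partrec.of_eq_tot (Partrec.nat_rec (g := fun _ => Part.some (φ (0 * c)))
      (h := fun _ q => G q.2) Computable.id (Computable.const _)
      (hG.comp (Computable.snd.comp Computable.snd)).to₂) fun n => Part.eq_some_iff.1 ?_
    induction n with
    | zero => rfl
    | succ n ih =>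
      simp only [id] at ih ⊢
      rw [ih, Part.bind_some, hstep]
  refine (Computable.cond (c := fun z : ℤ => decide (z.toNat = 0))
    (ComputablePred.eq_comp Primrec.int_toNat.to_comp (Computable.const 0)).decide
    ((hmul (-1)).comp Primrec.int_neg_toNat.to_comp)
    ((hmul 1).comp Primrec.int_toNat.to_comp)).of_eq fun z => ?_
  rw [Bool.cond_decide]
  split_ifs <;> congr 1 <;> omega

namespace IsDiophantine

open MvPolynomial

section

variable {R : Type*} [CommRing R] {ι κ τ : Type} [Fintype ι] [Fintype κ]

theorem of_finite [Finite τ] {A : Set (ι → R)} (p : MvPolynomial (ι ⊕ τ) R)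
    (h : ∀ t, t ∈ A ↔ ∃ x : τ → R, eval (Sum.elim t x) p = 0) : IsDiophantine R ι A := by
  obtain ⟨n, ⟨e⟩⟩ := Finite.exists_equiv_fin τ
  refine ⟨n, rename (Sum.map id e) p, fun t => (h t).trans ?_⟩
  simp only [eval_rename, Sum.elim_comp_map, Function.comp_id]
  exact ⟨fun ⟨x, hx⟩ => ⟨x ∘ e.symm, by simpa [Function.comp_assoc] using hx⟩,
    fun ⟨x, hx⟩ => ⟨x ∘ e, hx⟩⟩

theorem preimage_comp {A : Set (ι → R)} (hA : IsDiophantine R ι A) (f : ι → κ) :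
    IsDiophantine R κ {t | t ∘ f ∈ A} := by
  obtain ⟨n, p, hp⟩ := hA
  refine ⟨n, rename (Sum.map f id) p, fun t => (hp _).trans ?_⟩
  simp only [eval_rename, Sum.elim_comp_map, Function.comp_id]

theorem exists_elim [Fintype τ] {A : Set (ι ⊕ τ → R)} (hA : IsDiophantine R (ι ⊕ τ) A) :
    IsDiophantine R ι {t | ∃ x : τ → R, Sum.elim t x ∈ A} := by
  obtain ⟨n, p, hp⟩ := hA
  refine of_finite (τ := τ ⊕ Fin n) (rename (Equiv.sumAssoc ι τ (Fin n)) p) fun t => ?_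
  have key (x : τ → R) (y : Fin n → R) : Sum.elim t (Sum.elim x y) ∘ Equiv.sumAssoc ι τ (Fin n) =
      Sum.elim (Sum.elim t x) y := by
    ext ((i | i) | i) <;> rfl
  simp only [Set.mem_ofPred_eq, hp, eval_rename]
  constructor
  · rintro ⟨x, y, h⟩
    exact ⟨Sum.elim x y, by rwa [key]⟩
  · rintro ⟨x, h⟩
    refine ⟨x ∘ Sum.inl, x ∘ Sum.inr, ?_⟩
    rwa [← key, Sum.elim_comp_inl_inr]

end

section

variable {ι κ : Type} [Fintype ι]

theorem iInter [Fintype κ] {A : κ → Set (ι → ℚ)} (hA : ∀ j, IsDiophantine ℚ ι (A j)) :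
    IsDiophantine ℚ ι (⋂ j, A j) := by
  choose n p hp using hA
  refine of_finite (τ := Σ j, Fin (n j))
    (∑ j, rename (Sum.map id fun i => ⟨j, i⟩) (p j) ^ 2) fun t => ?_
  simp only [Set.mem_iInter, hp, map_sum, map_pow, eval_rename, Sum.elim_comp_map,
    Function.comp_id]
  have key (x : (Σ j, Fin (n j)) → ℚ) :
      ∑ j, eval (Sum.elim t (x ∘ fun i => ⟨j, i⟩)) (p j) ^ 2 = 0 ↔
        ∀ j, eval (Sum.elim t (x ∘ fun i => ⟨j, i⟩)) (p j) = 0 := by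
    rw [Finset.sum_eq_zero_iff_of_nonneg fun _ _ => sq_nonneg _]
    simp
  simp only [key]
  constructor
  · intro h
    choose x hx using h
    exact ⟨fun i => x i.1 i.2, hx⟩
  · rintro ⟨x, hx⟩ j
    exact ⟨_, hx j⟩

theorem inter {A B : Set (ι → ℚ)} (hA : IsDiophantine ℚ ι A) (hB : IsDiophantine ℚ ι B) :
    IsDiophantine ℚ ι (A ∩ B) := by
  rw [Set.inter_eq_iInter]
  exact iInter fun b => by cases b <;> assumption

theorem zeroLocus (p : MvPolynomial ι ℚ) : IsDiophantine ℚ ι {t | eval t p = 0} :=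
  of_finite (τ := Empty) (rename Sum.inl p) fun t => by
    simp [eval_rename]

theorem forall_eq [Fintype κ] (f g : κ → MvPolynomial ι ℚ) :
    IsDiophantine ℚ ι {t | ∀ i, eval t (f i) = eval t (g i)} := by
  have h : {t | ∀ i, eval t (f i) = eval t (g i)} = ⋂ i, {t | eval t (f i - g i) = 0} := by
    ext t
    simp [sub_eq_zero]
  rw [h]
  exact iInter fun i => zeroLocus _

end

end IsDiophantine

section Model

open MvPolynomial

variable {k : ℕ} {φ : ℤ → Fin k → ℚ}

/-- The graph of `f : ℤ^ν → ℤ`, transported along `φ : ℤ → ℚ^k`, is the trace on the image of `φ`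
of a Diophantine set over `ℚ`. -/
def HasDiophantineGraph {ν : Type} [Fintype ν] (φ : ℤ → Fin k → ℚ) (f : (ν → ℤ) → ℤ) : Prop :=
  ∃ S : Set ((ν × Fin k) ⊕ Fin k → ℚ), IsDiophantine ℚ ((ν × Fin k) ⊕ Fin k) S ∧
    ∀ (n : ν → ℤ) (t : Fin k → ℚ),
      Sum.elim (fun i => φ (n i.1) i.2) t ∈ S ↔ t = φ (f n)

theorem HasDiophantineGraph.const {ν : Type} [Fintype ν] (c : ℤ) :
    HasDiophantineGraph φ fun _ : ν → ℤ => c := by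
  refine ⟨_, IsDiophantine.forall_eq (fun i : Fin k => X (Sum.inr i)) (fun i => C (φ c i)),
    fun n t => ?_⟩
  simp [funext_iff]

theorem HasDiophantineGraph.proj {ν : Type} [Fintype ν] (j : ν) :
    HasDiophantineGraph φ fun n : ν → ℤ => n j := by
  refine ⟨_, IsDiophantine.forall_eq (fun i : Fin k => X (Sum.inr i))
    (fun i => X (Sum.inl (j, i))), fun n t => ?_⟩
  simp [funext_iff]

theorem HasDiophantineGraph.binop (hφ : Function.Injective φ) {op : ℤ → ℤ → ℤ}
    (hop : IsDiophantine ℚ (Fin 3 × Fin k)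
      {t | ∃ a b : ℤ, (∀ i, t (0, i) = φ a i) ∧ (∀ i, t (1, i) = φ b i) ∧
        ∀ i, t (2, i) = φ (op a b) i})
    {ν : Type} [Fintype ν] {f g : (ν → ℤ) → ℤ} (hf : HasDiophantineGraph φ f)
    (hg : HasDiophantineGraph φ g) : HasDiophantineGraph φ fun n => op (f n) (g n) := by
  obtain ⟨S, hS, hSf⟩ := hf
  obtain ⟨T, hT, hTg⟩ := hg
  refine ⟨_, (((hS.preimage_comp (κ := ((ν × Fin k) ⊕ Fin k) ⊕ (Fin k ⊕ Fin k))
    (Sum.elim (Sum.inl ∘ Sum.inl) (Sum.inr ∘ Sum.inl))).inter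
    (hT.preimage_comp (Sum.elim (Sum.inl ∘ Sum.inl) (Sum.inr ∘ Sum.inr)))).inter
    (hop.preimage_comp fun i =>
      ![Sum.inr (Sum.inl i.2), Sum.inr (Sum.inr i.2), Sum.inl (Sum.inr i.2)] i.1)).exists_elim,
    fun n t => ?_⟩
  simp only [Set.mem_ofPred_eq, Set.mem_inter_iff]
  simp only [Sum.comp_elim, ← Function.comp_assoc, Sum.elim_comp_inl, Sum.elim_comp_inr, hSf, hTg]
  constructor
  · rintro ⟨w, ⟨h1, h2⟩, a, b, h3, h4, h5⟩
    obtain rfl : a = f n := hφ ((funext h3).symm.trans h1)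
    obtain rfl : b = g n := hφ ((funext h4).symm.trans h2)
    exact funext h5
  · rintro rfl
    exact ⟨Sum.elim (φ (f n)) (φ (g n)), ⟨rfl, rfl⟩, f n, g n, fun _ => rfl, fun _ => rfl,
      fun _ => rfl⟩

theorem IsDiophantine.range_of_binop {op : ℤ → ℤ → ℤ}
    (hop : IsDiophantine ℚ (Fin 3 × Fin k)
      {t | ∃ a b : ℤ, (∀ i, t (0, i) = φ a i) ∧ (∀ i, t (1, i) = φ b i) ∧
        ∀ i, t (2, i) = φ (op a b) i}) : IsDiophantine ℚ (Fin k) (Set.range φ) := by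
  convert (hop.preimage_comp (κ := Fin k ⊕ (Fin k ⊕ Fin k)) fun i =>
    ![Sum.inl i.2, Sum.inr (Sum.inl i.2), Sum.inr (Sum.inr i.2)] i.1).exists_elim using 1
  ext t
  constructor
  · rintro ⟨a, rfl⟩
    exact ⟨Sum.elim (φ 0) (φ (op a 0)), a, 0, fun _ => rfl, fun _ => rfl, fun _ => rfl⟩
  · rintro ⟨w, a, b, h, -, -⟩
    exact ⟨a, (funext h).symm⟩

theorem HasDiophantineGraph.eval
    (hφ : Function.Injective φ)
    (hadd : IsDiophantine ℚ (Fin 3 × Fin k)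
      {t | ∃ a b : ℤ, (∀ i, t (0, i) = φ a i) ∧ (∀ i, t (1, i) = φ b i) ∧
        ∀ i, t (2, i) = φ (a + b) i})
    (hmul : IsDiophantine ℚ (Fin 3 × Fin k)
      {t | ∃ a b : ℤ, (∀ i, t (0, i) = φ a i) ∧ (∀ i, t (1, i) = φ b i) ∧
        ∀ i, t (2, i) = φ (a * b) i})
    {ν : Type} [Fintype ν] (p : MvPolynomial ν ℤ) :
    HasDiophantineGraph φ fun n => MvPolynomial.eval n p := by
  induction p using MvPolynomial.induction_on with
  | C c => simpa using HasDiophantineGraph.const c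
  | add p q hp hq => simpa using hp.binop hφ hadd hq
  | mul_X p i hp => simpa using hp.binop hφ hmul (HasDiophantineGraph.proj i)

/-- A model of `ℤ` in `ℚ^k` carries Diophantine subsets of `ℤ` to Diophantine subsets of `ℚ^k`. -/
theorem IsDiophantine.image_of_model
    (hφ : Function.Injective φ)
    (hadd : IsDiophantine ℚ (Fin 3 × Fin k)
      {t | ∃ a b : ℤ, (∀ i, t (0, i) = φ a i) ∧ (∀ i, t (1, i) = φ b i) ∧
        ∀ i, t (2, i) = φ (a + b) i})
    (hmul : IsDiophantine ℚ (Fin 3 × Fin k)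
      {t | ∃ a b : ℤ, (∀ i, t (0, i) = φ a i) ∧ (∀ i, t (1, i) = φ b i) ∧
        ∀ i, t (2, i) = φ (a * b) i})
    {A : Set ℤ} (hA : IsDiophantine ℤ (Fin 1) {t | t 0 ∈ A}) :
    IsDiophantine ℚ (Fin k) (φ '' A) := by
  obtain ⟨m, p, hp⟩ := hA
  obtain ⟨S, hS, hSp⟩ := HasDiophantineGraph.eval hφ hadd hmul p
  let block : Fin 1 ⊕ Fin m → Fin k → Fin k ⊕ ((Fin m × Fin k) ⊕ Fin k) := fun j i =>
    Sum.elim (fun _ => Sum.inl i) (fun j => Sum.inr (Sum.inl (j, i))) j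
  convert (((IsDiophantine.iInter fun j =>
    (IsDiophantine.range_of_binop hadd).preimage_comp (block j)).inter
    (IsDiophantine.forall_eq (fun i : Fin k => X (Sum.inr (Sum.inr i)))
      (fun i => C (φ 0 i)))).inter
    (hS.preimage_comp (Sum.elim (fun i => block i.1 i.2) (Sum.inr ∘ Sum.inr)))).exists_elim using 1
  ext t
  simp only [Set.mem_image, Set.mem_ofPred_eq, Set.mem_inter_iff, Set.mem_iInter, Set.mem_range,
    eval_X, eval_C, Sum.elim_inr]
  constructor
  · rintro ⟨a, ha, rfl⟩
    obtain ⟨x, hx⟩ := (hp fun _ => a).1 ha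
    refine ⟨Sum.elim (fun i => φ (x i.1) i.2) (φ 0), ⟨?_, fun _ => rfl⟩, ?_⟩
    · rintro (j | j)
      exacts [⟨a, rfl⟩, ⟨x j, rfl⟩]
    · convert (hSp (Sum.elim (fun _ => a) x) (φ 0)).2 (congrArg φ hx.symm) using 1
      ext (⟨j | j, i⟩ | i) <;> rfl
  · rintro ⟨w, ⟨hw, hz⟩, h⟩
    choose n hn using hw
    refine ⟨n (Sum.inl 0), ?_, hn (Sum.inl 0)⟩
    refine (hp fun _ => n (Sum.inl 0)).2 ⟨n ∘ Sum.inr, ?_⟩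
    have h' : Sum.elim (fun i : (Fin 1 ⊕ Fin m) × Fin k => φ (n i.1) i.2) (φ 0) ∈ S := by
      convert h using 1
      ext (⟨j, i⟩ | i)
      · exact congrFun (hn j) i
      · exact (hz i).symm
    have h0 := hφ ((hSp _ _).1 h')
    rw [h0]
    congr 2
    ext (j | j)
    · rw [Subsingleton.elim j 0]
      rfl
    · rfl

end Model

/-- If there is a Diophantine subset of `ℤ` which is not computable, and there is an
injection `φ : ℤ → ℚ^k` whose images of the graphs of addition and multiplication are
Diophantine over `ℚ`, then there is a Diophantine subset of `ℚ^k` which is not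
computable. -/
theorem undecidable_diophantine_set_over_Q_of_model
    (hZ : ∃ A : Set ℤ, IsDiophantine ℤ (Fin 1) {t | t 0 ∈ A} ∧
      ¬ ComputablePred (fun n : ℤ => n ∈ A))
    (k : ℕ) (φ : ℤ → (Fin k → ℚ)) (hφ : Function.Injective φ)
    (hadd : IsDiophantine ℚ (Fin 3 × Fin k)
      {t | ∃ a b : ℤ, (∀ i, t (0, i) = φ a i) ∧ (∀ i, t (1, i) = φ b i) ∧
        ∀ i, t (2, i) = φ (a + b) i})
    (hmul : IsDiophantine ℚ (Fin 3 × Fin k)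
      {t | ∃ a b : ℤ, (∀ i, t (0, i) = φ a i) ∧ (∀ i, t (1, i) = φ b i) ∧
        ∀ i, t (2, i) = φ (a * b) i}) :
    ∃ B : Set (Fin k → ℚ), IsDiophantine ℚ (Fin k) B ∧
      ¬ ComputablePred (fun t : Fin k → ℚ => t ∈ B) := by
  obtain ⟨A, hA, hcomp⟩ := hZ
  refine ⟨φ '' A, IsDiophantine.image_of_model hφ hadd hmul hA, fun hB => hcomp ?_⟩
  obtain ⟨d, hd, hdB⟩ := ComputablePred.computable_iff.1 hB
  refine ComputablePred.computable_iff.2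
    ⟨_, hd.comp (computable_of_isDiophantine_add hφ hadd), funext fun n => ?_⟩
  rw [← congrFun hdB (φ n), hφ.mem_set_image]
end

section
/- (Cornelissen–Zahidi) Assume Mazur's conjecture in the following form: for every n and every finite family of polynomials p₁,…,p_r ∈ ℚ[x₁,…,x_n], the topological closure in ℝⁿ of the set {x ∈ ℚⁿ : p₁(x) = ⋯ = p_r(x) = 0} has only finitely many connected components. Then there is no Diophantine model of ℤ over ℚ; that is, there exist no k ∈ ℕ and injective map φ : ℤ → ℚ^k such that the sets {(φ(a), φ(b), φ(a+b)) : a, b ∈ ℤ} and {(φ(a), φ(b), φ(a·b)) : a, b ∈ ℤ} are Diophantine subsets of ℚ^{3k}. -/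
/-- Mazur's conjecture (affine form): for every finite family of polynomials over `ℚ`
in `n` variables, the topological closure in `ℝⁿ` of the set of their common rational
zeros has only finitely many connected components. -/
def MazurConjecture : Prop :=
  ∀ (n r : ℕ) (p : Fin r → MvPolynomial (Fin n) ℚ),
    Finite (ConnectedComponents
      (closure {x : Fin n → ℝ | ∃ q : Fin n → ℚ,
        (∀ i, x i = (q i : ℝ)) ∧ ∀ j, MvPolynomial.eval q (p j) = 0} : Set (Fin n → ℝ)))

/-- Polynomial functions `ℕ^γ → ℕ` with natural number coefficients. -/
inductive IsNatPoly {γ : Type} : ((γ → ℕ) → ℕ) → Prop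
  | proj (i : γ) : IsNatPoly fun x => x i
  | const (n : ℕ) : IsNatPoly fun _ => n
  | add {F G : (γ → ℕ) → ℕ} : IsNatPoly F → IsNatPoly G → IsNatPoly fun x => F x + G x
  | mul {F G : (γ → ℕ) → ℕ} : IsNatPoly F → IsNatPoly G → IsNatPoly fun x => F x * G x

namespace IsNatPoly

variable {γ : Type} {F : (γ → ℕ) → ℕ}

theorem mono (hF : IsNatPoly F) {w w' : γ → ℕ} (h : w ≤ w') : F w ≤ F w' := by
  induction hF with
  | proj i => exact h i
  | const n => exact le_rfl
  | add _ _ h₁ h₂ => exact add_le_add h₁ h₂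
  | mul _ _ h₁ h₂ => exact Nat.mul_le_mul h₁ h₂

theorem modEq (hF : IsNatPoly F) {n : ℕ} {w w' : γ → ℕ} (h : ∀ i, w i ≡ w' i [MOD n]) :
    F w ≡ F w' [MOD n] := by
  induction hF with
  | proj i => exact h i
  | const n => rfl
  | add _ _ h₁ h₂ => exact h₁.add h₂
  | mul _ _ h₁ h₂ => exact h₁.mul h₂

theorem diophFn_comp (hF : IsNatPoly F) {α : Type} {g : γ → (α → ℕ) → ℕ}
    (hg : ∀ i, Dioph.DiophFn (g i)) : Dioph.DiophFn fun v => F fun i => g i v := by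
  induction hF with
  | proj i => exact hg i
  | const n => exact Dioph.const_dioph n
  | add _ _ h₁ h₂ => exact Dioph.add_dioph h₁ h₂
  | mul _ _ h₁ h₂ => exact Dioph.mul_dioph h₁ h₂

theorem comap (hF : IsNatPoly F) {δ : Type} (f : γ → δ) : IsNatPoly fun w => F (w ∘ f) := by
  induction hF with
  | proj i => exact .proj (f i)
  | const n => exact .const n
  | add _ _ h₁ h₂ => exact .add h₁ h₂
  | mul _ _ h₁ h₂ => exact .mul h₁ h₂

theorem exists_finset (hF : IsNatPoly F) :
    ∃ s : Finset γ, ∀ w w' : γ → ℕ, (∀ i ∈ s, w i = w' i) → F w = F w' := by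
  classical
  induction hF with
  | proj i => exact ⟨{i}, fun w w' h => h i (by simp)⟩
  | const n => exact ⟨∅, fun _ _ _ => rfl⟩
  | add _ _ h₁ h₂ =>
    obtain ⟨s, hs⟩ := h₁
    obtain ⟨t, ht⟩ := h₂
    refine ⟨s ∪ t, fun w w' h => ?_⟩
    simp only [hs w w' fun i hi => h i (by simp [hi]), ht w w' fun i hi => h i (by simp [hi])]
  | mul _ _ h₁ h₂ =>
    obtain ⟨s, hs⟩ := h₁
    obtain ⟨t, ht⟩ := h₂
    refine ⟨s ∪ t, fun w w' h => ?_⟩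
    simp only [hs w w' fun i hi => h i (by simp [hi]), ht w w' fun i hi => h i (by simp [hi])]

end IsNatPoly

theorem Poly.exists_isNatPoly_sub {γ : Type} (p : Poly γ) :
    ∃ F G : (γ → ℕ) → ℕ, IsNatPoly F ∧ IsNatPoly G ∧ ∀ w, p w = F w - G w := by
  induction p using Poly.induction with
  | H1 i => exact ⟨_, _, .proj i, .const 0, fun w => by simp⟩
  | H2 n => exact ⟨_, _, .const n.toNat, .const (-n).toNat, fun w => by simp⟩
  | H3 p q hp hq =>
    obtain ⟨F, G, hF, hG, h⟩ := hp
    obtain ⟨F', G', hF', hG', h'⟩ := hq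
    exact ⟨_, _, hF.add hG', hG.add hF', fun w => by simp [h, h']; ring⟩
  | H4 p q hp hq =>
    obtain ⟨F, G, hF, hG, h⟩ := hp
    obtain ⟨F', G', hF', hG', h'⟩ := hq
    exact ⟨_, _, (hF.mul hF').add (hG.mul hG'), (hF.mul hG').add (hG.mul hF'),
      fun w => by simp [h, h']; ring⟩

theorem Dioph.exists_isNatPoly {α : Type} {S : Set (α → ℕ)} (hS : Dioph S) :
    ∃ (β : Type) (_ : Finite β) (F G : (α ⊕ β → ℕ) → ℕ), IsNatPoly F ∧ IsNatPoly G ∧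
      ∀ v, v ∈ S ↔ ∃ t, F (Sum.elim v t) = G (Sum.elim v t) := by
  classical
  obtain ⟨β, p, hp⟩ := hS
  obtain ⟨F, G, hF, hG, h⟩ := p.exists_isNatPoly_sub
  obtain ⟨s, hs⟩ := hF.exists_finset
  obtain ⟨s', hs'⟩ := hG.exists_finset
  let B : Finset β := (s ∪ s').toRight
  let f : β → Option B := fun b => if hb : b ∈ B then some ⟨b, hb⟩ else none
  refine ⟨Option B, inferInstance, _, _, hF.comap (Sum.map id f), hG.comap (Sum.map id f),
    fun v => ?_⟩
  have hfg : ∀ t, p (Sum.elim v t) = 0 ↔ F (Sum.elim v t) = G (Sum.elim v t) := fun t => by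
    rw [h]; omega
  simp only [hp, hfg, Sum.elim_comp_map, Function.comp_id]
  constructor
  · rintro ⟨t, ht⟩
    refine ⟨fun o => o.elim 0 fun b => t b, ?_⟩
    rw [hs _ (Sum.elim v t), hs' _ (Sum.elim v t), ht]
    · rintro (a | b) hi
      · rfl
      · have : b ∈ B := by simp [B, hi]
        simp [f, this]
    · rintro (a | b) hi
      · rfl
      · have : b ∈ B := by simp [B, hi]
        simp [f, this]
  · rintro ⟨t, ht⟩
    exact ⟨_, ht⟩

/-- The digit of `(B + 1)^n` in base `B = 2^n + 1` at position `k` is `n.choose k`. -/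
theorem Nat.choose_eq_pow_div_mod (n k : ℕ) :
    n.choose k = (2 ^ n + 1 + 1) ^ n / (2 ^ n + 1) ^ k % (2 ^ n + 1) := by
  set B := 2 ^ n + 1 with hB
  have hB1 : 1 < B := by have := Nat.two_pow_pos n; omega
  have key : (B + 1) ^ n = Nat.ofDigits B ((List.range (n + 1)).map n.choose) := by
    simp only [add_pow, Nat.cast_id]
    rw [Nat.ofDigits_eq_sum_mapIdx, ← Fin.sum_univ_eq_sum_range
      fun x => B ^ x * 1 ^ (n - x) * n.choose x]
    simp only [List.mapIdx_eq_ofFn, List.sum_ofFn, one_pow, mul_one]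
    refine Fintype.sum_equiv (finCongr (by simp)) _ _ fun x => ?_
    simp [mul_comm]
  have hdig : Nat.digits B ((B + 1) ^ n) = (List.range (n + 1)).map n.choose := by
    rw [key]
    refine Nat.digits_ofDigits B hB1 _ (fun l hl => ?_) (fun h => ?_)
    · obtain ⟨i, -, rfl⟩ := List.mem_map.1 hl
      have := Nat.choose_le_two_pow n i
      omega
    · simp
  rw [← Nat.getD_digits _ _ hB1, hdig]
  rcases lt_or_ge k (n + 1) with h | h
  · simp [List.getD_eq_getElem?_getD, h]
  · rw [List.getD_eq_default _ _ (by simpa using h), Nat.choose_eq_zero_of_lt h]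

theorem Nat.pow_mul_add_le (s m k : ℕ) :
    (s + m) ^ k * (s + m) ≤ (s + m) * s ^ k + k * m * (s + m) ^ k := by
  induction k with
  | zero => simp
  | succ k ih =>
    have h1 : s ^ k ≤ (s + m) ^ k := Nat.pow_le_pow_left (by omega) k
    have h2 := Nat.mul_le_mul_left (s + m) ih
    have h3 := Nat.mul_le_mul_left ((s + m) * m) h1
    rw [pow_succ, pow_succ]
    nlinarith

theorem Nat.factorial_eq_pow_div_choose (n r : ℕ) (hr : n ^ 2 * (n.factorial + 1) < r) :
    n.factorial = r ^ n / r.choose n := by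
  have hnr : n ≤ r := by nlinarith [Nat.factorial_pos n, sq_nonneg n, Nat.le_self_pow two_ne_zero n]
  have hc : 0 < r.choose n := Nat.choose_pos hnr
  symm
  rw [Nat.div_eq_iff hc]
  have h1 : r.descFactorial n = n.factorial * r.choose n :=
    Nat.descFactorial_eq_factorial_mul_choose r n
  have h2 : r.descFactorial n ≤ r ^ n := Nat.descFactorial_le_pow r n
  refine ⟨by rw [← h1]; exact h2, ?_⟩
  obtain ⟨s, rfl⟩ := Nat.exists_eq_add_of_le' hnr
  have h3 : s ^ n ≤ (s + n).descFactorial n :=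
    (Nat.pow_le_pow_left (by omega) n).trans (Nat.pow_sub_le_descFactorial (s + n) n)
  have h4 := Nat.pow_mul_add_le s n n
  have h5 : n.factorial * (s + n) ^ n < (n.factorial + 1) * (s + n).descFactorial n := by
    have hpos : 0 < (s + n) ^ n := Nat.pow_pos (by omega)
    have h6 := Nat.mul_lt_mul_of_pos_right hr hpos
    have h7 := Nat.mul_le_mul_left ((n.factorial + 1) * (s + n)) h3
    have h8 := Nat.mul_le_mul_left (n.factorial + 1) h4
    refine Nat.lt_of_mul_lt_mul_left (a := s + n) ?_
    nlinarith
  rw [h1, mul_left_comm] at h5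
  have h9 := Nat.lt_of_mul_lt_mul_left h5
  rw [add_mul, one_mul] at h9
  omega

theorem Dioph.choose_dioph {α : Type} {f g : (α → ℕ) → ℕ} (hf : DiophFn f) (hg : DiophFn g) :
    DiophFn fun v => (f v).choose (g v) := by
  have h1 : DiophFn fun v : α → ℕ => 2 ^ f v + 1 :=
    add_dioph (pow_dioph (const_dioph 2) hf) (const_dioph 1)
  simp only [Nat.choose_eq_pow_div_mod]
  exact mod_dioph (div_dioph (pow_dioph (add_dioph h1 (const_dioph 1)) hf) (pow_dioph h1 hg)) h1

theorem Dioph.factorial_dioph {α : Type} {f : (α → ℕ) → ℕ} (hf : DiophFn f) :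
    DiophFn fun v => (f v).factorial := by
  have h : ∀ n : ℕ, n ^ 2 * (n.factorial + 1) < n ^ 2 * (n ^ n + 1) + 1 := fun n => by
    have := Nat.factorial_le_pow n
    exact Nat.lt_succ_of_le (Nat.mul_le_mul_left _ (by omega))
  simp only [fun n : ℕ => Nat.factorial_eq_pow_div_choose n _ (h n)]
  have h1 := add_dioph (mul_dioph (pow_dioph hf (const_dioph 2))
    (add_dioph (pow_dioph hf hf) (const_dioph 1))) (const_dioph 1)
  exact div_dioph (pow_dioph h1 hf) (choose_dioph h1 hf)

theorem Dioph.descFactorial_dioph {α : Type} {f g : (α → ℕ) → ℕ} (hf : DiophFn f)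
    (hg : DiophFn g) : DiophFn fun v => (f v).descFactorial (g v) := by
  simp only [Nat.descFactorial_eq_factorial_mul_choose]
  exact mul_dioph (factorial_dioph hg) (choose_dioph hf hg)

theorem Dioph.setOf_forall_dioph {α ι : Type} [Finite ι] {S : ι → Set (α → ℕ)}
    (hS : ∀ i, Dioph (S i)) : Dioph {v | ∀ i, v ∈ S i} := by
  have := Fintype.ofFinite ι
  refine ext (DiophList.forall (Finset.univ.toList.map S) ?_) fun v => ?_
  · rw [List.forall_map_iff, List.forall_iff_forall_mem]
    exact fun i _ => hS i
  · simp [List.forall_iff_forall_mem]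

section BoundedForall

variable {Q y T : ℕ}

theorem Nat.prod_range_div_sub_one_eq_choose (h : ∀ k < y, k + 1 ∣ T) :
    ∏ k ∈ Finset.range y, (T / (k + 1) - 1) = (T - 1).choose y := by
  induction y with
  | zero => simp
  | succ y ih =>
    rw [Finset.prod_range_succ, ih fun k hk => h k (by omega)]
    refine Nat.eq_of_mul_eq_mul_right (Nat.succ_pos y) ?_
    rw [Nat.choose_succ_right_eq, mul_assoc, Nat.sub_mul, Nat.succ_eq_add_one,
      Nat.div_mul_cancel (h y (by omega))]
    congr 1
    omega

theorem Nat.succ_dvd_factorial_sq {k : ℕ} (hk : k < Q) : k + 1 ∣ Q.factorial ^ 2 :=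
  dvd_pow (Nat.dvd_factorial (by omega) (by omega)) two_ne_zero

theorem Nat.factorial_dvd_factorial_sq_div {k : ℕ} (hk : k < Q) :
    Q.factorial ∣ Q.factorial ^ 2 / (k + 1) := by
  rw [sq, Nat.mul_div_assoc _ (Nat.dvd_factorial (by omega) (by omega))]
  exact dvd_mul_right _ _

theorem Nat.factorial_le_factorial_sq_div {k : ℕ} (hk : k < Q) :
    Q.factorial ≤ Q.factorial ^ 2 / (k + 1) :=
  Nat.le_of_dvd (Nat.div_pos (Nat.le_of_dvd (by positivity) (Nat.succ_dvd_factorial_sq hk))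
    (by omega)) (Nat.factorial_dvd_factorial_sq_div hk)

theorem Nat.Prime.lt_of_dvd_factorial_sq_div_sub_one {k p : ℕ} (hp : p.Prime) (hk : k < Q)
    (h : p ∣ Q.factorial ^ 2 / (k + 1) - 1) : Q < p := by
  by_contra! hpQ
  have h1 : p ∣ Q.factorial ^ 2 / (k + 1) :=
    ((Nat.dvd_factorial hp.pos hpQ)).trans (Nat.factorial_dvd_factorial_sq_div hk)
  have h2 := Nat.factorial_le_factorial_sq_div hk
  have h3 := Nat.factorial_pos Q
  have h4 := (Nat.dvd_sub_iff_right (by omega) h1).1 h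
  exact hp.one_lt.ne' (Nat.dvd_one.1 h4)

theorem Nat.factorial_sq_sub_one_modEq {k : ℕ} (hk : k < Q) :
    Q.factorial ^ 2 - 1 ≡ k [MOD Q.factorial ^ 2 / (k + 1) - 1] := by
  have h1 := Nat.factorial_le_factorial_sq_div hk
  have h2 := Nat.factorial_pos Q
  have h3 := Nat.mul_div_cancel' (Nat.succ_dvd_factorial_sq hk)
  have h4 : Q.factorial ^ 2 - 1 = k + (Q.factorial ^ 2 / (k + 1) - 1) * (k + 1) := by
    obtain ⟨z, hz⟩ := Nat.exists_eq_add_of_le' (h2.trans_le h1)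
    rw [hz] at h3 ⊢
    rw [← h3, Nat.add_sub_cancel, mul_comm, add_mul]
    omega
  rw [h4]
  simp [Nat.ModEq]

theorem Nat.coprime_factorial_sq_div_sub_one {i j : ℕ} (hi : i < Q) (hj : j < Q) (hij : i ≠ j) :
    Nat.Coprime (Q.factorial ^ 2 / (i + 1) - 1) (Q.factorial ^ 2 / (j + 1) - 1) := by
  refine Nat.Coprime.symm (Nat.coprime_of_dvd fun p hp hpj hpi => ?_)
  have hQ := hp.lt_of_dvd_factorial_sq_div_sub_one hi hpi
  have h := ((Nat.factorial_sq_sub_one_modEq hi).of_dvd hpi).symm.trans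
    ((Nat.factorial_sq_sub_one_modEq hj).of_dvd hpj)
  exact hij (h.eq_of_lt_of_lt (hi.trans hQ) (hj.trans hQ))

/-- Elimination of a bounded universal quantifier in front of a polynomial equation with
bounded unknowns. -/
theorem IsNatPoly.forall_lt_exists_le_iff {α β : Type} [Finite β]
    {F G : (Option α ⊕ β → ℕ) → ℕ} (hF : IsNatPoly F) (hG : IsNatPoly G) (v : α → ℕ) {u : ℕ}
    (hy : y ≤ Q) (hu : u < Q) (h3 : 3 ≤ Q)
    (hFQ : F (Sum.elim (Option.elim' y v) fun _ => u) ≤ Q)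
    (hGQ : G (Sum.elim (Option.elim' y v) fun _ => u) ≤ Q) :
    (∀ x < y, ∃ t : β → ℕ, (∀ j, t j ≤ u) ∧
      F (Sum.elim (Option.elim' x v) t) = G (Sum.elim (Option.elim' x v) t)) ↔
    ∃ a : β → ℕ,
      (∀ j, (Q.factorial ^ 2 - 1).choose y ∣ (a j).descFactorial (u + 1)) ∧
      F (Sum.elim (Option.elim' (Q.factorial ^ 2 - 1) v) a) ≡
        G (Sum.elim (Option.elim' (Q.factorial ^ 2 - 1) v) a)
          [MOD (Q.factorial ^ 2 - 1).choose y] := by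
  rw [← Nat.prod_range_div_sub_one_eq_choose
    fun k hk => Nat.succ_dvd_factorial_sq (hk.trans_le hy)]
  set m : ℕ → ℕ := fun k => Q.factorial ^ 2 / (k + 1) - 1 with hm
  have hsubst : ∀ {x p : ℕ} {t a : β → ℕ}, x < y → p ∣ m x → (∀ j, t j ≡ a j [MOD p]) →
      ∀ i, Sum.elim (Option.elim' (Q.factorial ^ 2 - 1) v) a i ≡
        Sum.elim (Option.elim' x v) t i [MOD p] := by
    rintro x p t a hx hp h ((_ | i) | j)
    · exact (Nat.factorial_sq_sub_one_modEq (hx.trans_le hy)).of_dvd hp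
    · exact Nat.ModEq.rfl
    · exact (h j).symm
  have hcop : ((Finset.range y : Finset ℕ) : Set ℕ).Pairwise (Function.onFun Nat.Coprime m) := by
    intro i hi j hj hij
    simp only [Finset.coe_range, Set.mem_Iio] at hi hj
    exact Nat.coprime_factorial_sq_div_sub_one (hi.trans_le hy) (hj.trans_le hy) hij
  have hprod : ∀ {b c : ℕ}, (∀ x < y, b ≡ c [MOD m x]) →
      b ≡ c [MOD ∏ k ∈ Finset.range y, m k] := fun {b c} h => by
    refine (Nat.modEq_list_map_prod_iff (s := m) (l := List.range y) ?_).2 fun x hx =>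
      h x (List.mem_range.1 hx)
    exact List.nodup_range.pairwise_of_forall_ne fun i hi j hj hij =>
      hcop (by simpa using hi) (by simpa using hj) hij
  constructor
  · intro h
    choose! t ht hFG using h
    have hm0 : ∀ i ∈ Finset.range y, m i ≠ 0 := fun i hi => by
      have h1 := Nat.factorial_le_factorial_sq_div ((Finset.mem_range.1 hi).trans_le hy)
      have h2 := Nat.self_le_factorial Q
      simp only [hm]
      omega
    let a : β → ℕ := fun j =>
      (Nat.chineseRemainderOfFinset (fun i => t i j) m (Finset.range y) hm0 hcop : ℕ)
    have ha : ∀ x < y, ∀ j, t x j ≡ a j [MOD m x] := fun x hx j =>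
      ((Nat.chineseRemainderOfFinset (fun i => t i j) m (Finset.range y) hm0 hcop).2 x
        (Finset.mem_range.2 hx)).symm
    refine ⟨a, fun j => ?_, ?_⟩
    · refine Nat.modEq_zero_iff_dvd.1 (hprod fun x hx => Nat.modEq_zero_iff_dvd.2 ?_)
      rw [Nat.descFactorial_eq_prod_range]
      refine dvd_trans ?_ (Finset.dvd_prod_of_mem _
        (Finset.mem_range.2 (Nat.lt_succ_of_le (ht x hx j))))
      rcases le_total (t x j) (a j) with h | h
      · exact (Nat.modEq_iff_dvd' h).1 (ha x hx j)
      · simp [Nat.sub_eq_zero_of_le h]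
    · refine hprod fun x hx => ?_
      have hs := hsubst hx dvd_rfl (ha x hx)
      exact (hF.modEq hs).trans (hFG x hx ▸ (hG.modEq hs).symm)
  · rintro ⟨a, ha, hFG⟩ x hx
    have hxm : m x ∣ ∏ k ∈ Finset.range y, m k := Finset.dvd_prod_of_mem m (Finset.mem_range.2 hx)
    have hm1 : m x ≠ 1 := by
      have h1 := Nat.factorial_le_factorial_sq_div (hx.trans_le hy)
      have h2 := Nat.self_le_factorial Q
      simp only [hm]
      omega
    obtain ⟨p, hp, hpm⟩ := Nat.exists_prime_and_dvd hm1
    have hQp : Q < p := hp.lt_of_dvd_factorial_sq_div_sub_one (hx.trans_le hy) hpm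
    have hex : ∀ j, ∃ s ≤ u, s ≡ a j [MOD p] := fun j => by
      have h1 : p ∣ (a j).descFactorial (u + 1) := (hpm.trans hxm).trans (ha j)
      rw [Nat.descFactorial_eq_prod_range, hp.prime.dvd_finsetProd_iff] at h1
      obtain ⟨i, hi, hpi⟩ := h1
      rw [Finset.mem_range] at hi
      rcases le_total i (a j) with h | h
      · exact ⟨i, by omega, (Nat.modEq_iff_dvd' h).2 hpi⟩
      · exact ⟨a j, by omega, rfl⟩
    choose t ht hta using hex
    refine ⟨t, ht, ?_⟩
    have hle : Sum.elim (Option.elim' x v) t ≤ Sum.elim (Option.elim' y v) fun _ => u := by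
      rintro ((_ | i) | j)
      · exact hx.le
      · exact le_rfl
      · exact ht j
    have hs := hsubst hx hpm hta
    have hmod := ((hF.modEq hs).symm.trans (hFG.of_dvd (hpm.trans hxm))).trans (hG.modEq hs)
    exact hmod.eq_of_lt_of_lt (((hF.mono hle).trans hFQ).trans_lt hQp)
      (((hG.mono hle).trans hGQ).trans_lt hQp)

end BoundedForall

theorem IsNatPoly.diophFn_subst {α β γ : Type} {F : (Option α ⊕ β → ℕ) → ℕ} (hF : IsNatPoly F)
    {y : (γ → ℕ) → ℕ} {v : α → (γ → ℕ) → ℕ} {t : β → (γ → ℕ) → ℕ} (hy : Dioph.DiophFn y)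
    (hv : ∀ i, Dioph.DiophFn (v i)) (ht : ∀ j, Dioph.DiophFn (t j)) :
    Dioph.DiophFn fun w => F (Sum.elim (Option.elim' (y w) fun i => v i w) fun j => t j w) := by
  have h := hF.diophFn_comp (g := Sum.elim (Option.elim' y v) t) (by
    rintro ((_ | i) | j)
    exacts [hy, hv i, ht j])
  convert! h using 3 with w
  funext i
  rcases i with (_ | i) | j <;> rfl

/-- Diophantine sets are closed under bounded universal quantification. -/
theorem Dioph.setOf_forall_lt_dioph {α : Type} {S : Set (Option α → ℕ)} (hS : Dioph S)
    {f : (α → ℕ) → ℕ} (hf : DiophFn f) : Dioph {v | ∀ x < f v, Option.elim' x v ∈ S} := by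
  obtain ⟨β, _, F, G, hF, hG, hFG⟩ := hS.exists_isNatPoly
  have := Fintype.ofFinite β
  let Q : (α → ℕ) → ℕ → ℕ := fun v u =>
    F (Sum.elim (Option.elim' (f v) v) fun _ => u) +
      G (Sum.elim (Option.elim' (f v) v) fun _ => u) + (f v + (u + 3))
  let T : (α → ℕ) → ℕ → ℕ := fun v u => (Q v u).factorial ^ 2 - 1
  have hp : ∀ i : α ⊕ Option β, DiophFn fun w : α ⊕ Option β → ℕ => w i := proj_dioph
  have hf' : DiophFn fun w : α ⊕ Option β → ℕ => f (w ∘ Sum.inl) := reindex_diophFn Sum.inl hf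
  have hu := hp (Sum.inr none)
  have hQ : DiophFn fun w : α ⊕ Option β → ℕ => Q (w ∘ Sum.inl) (w (Sum.inr none)) :=
    add_dioph (add_dioph (hF.diophFn_subst hf' (fun i => hp (Sum.inl i)) fun _ => hu)
      (hG.diophFn_subst hf' (fun i => hp (Sum.inl i)) fun _ => hu))
      (add_dioph hf' (add_dioph hu (const_dioph 3)))
  have hT : DiophFn fun w : α ⊕ Option β → ℕ => T (w ∘ Sum.inl) (w (Sum.inr none)) :=
    sub_dioph (pow_dioph (factorial_dioph hQ) (const_dioph 2)) (const_dioph 1)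
  have hM := choose_dioph hT hf'
  have hD := inter
    (setOf_forall_dioph fun j : β =>
      dvd_dioph hM (descFactorial_dioph (hp (Sum.inr (some j))) (add_dioph hu (const_dioph 1))))
    (modEq_dioph (hF.diophFn_subst hT (fun i => hp (Sum.inl i)) fun j => hp (Sum.inr (some j)))
      (hG.diophFn_subst hT (fun i => hp (Sum.inl i)) fun j => hp (Sum.inr (some j))) hM)
  refine ext (ex_dioph hD) fun v => ?_
  have key : ∀ u, _ := fun u => hF.forall_lt_exists_le_iff hG v (y := f v) (Q := Q v u) (u := u)
    (by simp only [Q]; omega) (by simp only [Q]; omega) (by simp only [Q]; omega)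
    (by simp only [Q]; omega) (by simp only [Q]; omega)
  simp only [Set.mem_ofPred_eq, hFG]
  constructor
  · rintro ⟨a, ha⟩ x hx
    obtain ⟨t, -, ht⟩ := (key (a none)).2 ⟨fun j => a (some j), ha⟩ x hx
    exact ⟨t, ht⟩
  · intro h
    choose! t ht using h
    let u := ∑ x ∈ Finset.range (f v), ∑ j, t x j
    obtain ⟨a, ha⟩ := (key u).1 fun x hx => ⟨t x, fun j =>
      (Finset.single_le_sum (f := t x) (fun _ _ => Nat.zero_le _) (Finset.mem_univ j)).trans
        (Finset.single_le_sum (f := fun x => ∑ j, t x j) (fun _ _ => Nat.zero_le _)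
          (Finset.mem_range.2 hx)), ht x hx⟩
    exact ⟨Option.elim' u a, ha⟩

/-- The rational number `(a - b) / (c + 1)` given by a triple `(a, b, c)` of natural numbers. -/
def ratOfNats (e : Fin 3 → ℕ) : ℚ := ((e 0 : ℚ) - e 1) / (e 2 + 1)

theorem ratOfNats_surjective : Function.Surjective ratOfNats := fun q => by
  refine ⟨![q.num.toNat, (-q.num).toNat, q.den - 1], ?_⟩
  have h1 : ((q.num.toNat : ℤ) : ℚ) - (((-q.num).toNat : ℤ) : ℚ) = (q.num : ℚ) := by
    rw [← Int.cast_sub, Int.toNat_sub_toNat_neg]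
  have h2 : ((q.den - 1 : ℕ) : ℚ) + 1 = q.den := by
    have := q.pos
    exact_mod_cast Nat.sub_add_cancel this
  simp only [ratOfNats, Matrix.cons_val]
  rw [h2]
  push_cast at h1
  conv_rhs => rw [← Rat.num_div_den q, ← h1]

theorem ratOfNats_lt_iff (a b : Fin 3 → ℕ) : ratOfNats a < ratOfNats b ↔
    a 0 * (b 2 + 1) + b 1 * (a 2 + 1) < b 0 * (a 2 + 1) + a 1 * (b 2 + 1) := by
  rw [ratOfNats, ratOfNats, div_lt_div_iff₀ (by positivity) (by positivity), ← @Nat.cast_lt ℚ]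
  push_cast
  constructor <;> intro h <;> linarith

theorem MvPolynomial.exists_isNatPoly_div {σ : Type} (p : MvPolynomial σ ℚ) :
    ∃ F G H : (σ × Fin 3 → ℕ) → ℕ, IsNatPoly F ∧ IsNatPoly G ∧ IsNatPoly H ∧ (∀ w, 0 < H w) ∧
      ∀ w, MvPolynomial.eval (fun j => ratOfNats fun e => w (j, e)) p =
        ((F w : ℚ) - G w) / H w := by
  induction p using MvPolynomial.induction_on with
  | C q =>
    obtain ⟨e, rfl⟩ := ratOfNats_surjective q
    exact ⟨_, _, _, .const (e 0), .const (e 1), .const (e 2 + 1), fun _ => Nat.succ_pos _,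
      fun w => by simp [ratOfNats]⟩
  | add p q hp hq =>
    obtain ⟨F, G, H, hF, hG, hH, h0, h⟩ := hp
    obtain ⟨F', G', H', hF', hG', hH', h0', h'⟩ := hq
    refine ⟨_, _, _, (hF.mul hH').add (hF'.mul hH), (hG.mul hH').add (hG'.mul hH), hH.mul hH',
      fun w => Nat.mul_pos (h0 w) (h0' w), fun w => ?_⟩
    have h1 : (H w : ℚ) ≠ 0 := by exact_mod_cast (h0 w).ne'
    have h2 : (H' w : ℚ) ≠ 0 := by exact_mod_cast (h0' w).ne'
    rw [map_add, h, h']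
    push_cast
    field_simp
    ring
  | mul_X p i hp =>
    obtain ⟨F, G, H, hF, hG, hH, h0, h⟩ := hp
    refine ⟨_, _, _, (hF.mul (.proj (i, 0))).add (hG.mul (.proj (i, 1))),
      (hF.mul (.proj (i, 1))).add (hG.mul (.proj (i, 0))),
      hH.mul (.add (.proj (i, 2)) (.const 1)),
      fun w => Nat.mul_pos (h0 w) (Nat.succ_pos _), fun w => ?_⟩
    have h1 : (H w : ℚ) ≠ 0 := by exact_mod_cast (h0 w).ne'
    have h2 : (w (i, 2) : ℚ) + 1 ≠ 0 := by positivity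
    rw [map_mul, h, MvPolynomial.eval_X, ratOfNats]
    push_cast
    field_simp
    ring

namespace Dioph

variable {α : Type}

theorem ratOfNats_lt_dioph {a b : Fin 3 → (α → ℕ) → ℕ} (ha : ∀ e, DiophFn (a e))
    (hb : ∀ e, DiophFn (b e)) :
    Dioph {v | ratOfNats (fun e => a e v) < ratOfNats fun e => b e v} := by
  simp only [ratOfNats_lt_iff]
  have h1 := const_dioph (α := α) 1
  exact lt_dioph
    (add_dioph (mul_dioph (ha 0) (add_dioph (hb 2) h1)) (mul_dioph (hb 1) (add_dioph (ha 2) h1)))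
    (add_dioph (mul_dioph (hb 0) (add_dioph (ha 2) h1)) (mul_dioph (ha 1) (add_dioph (hb 2) h1)))

theorem ratOfNats_le_dioph {a b : Fin 3 → (α → ℕ) → ℕ} (ha : ∀ e, DiophFn (a e))
    (hb : ∀ e, DiophFn (b e)) :
    Dioph {v | ratOfNats (fun e => a e v) ≤ ratOfNats fun e => b e v} := by
  simp only [← not_lt, ratOfNats_lt_iff]
  simp only [not_lt]
  have h1 := const_dioph (α := α) 1
  exact le_dioph
    (add_dioph (mul_dioph (ha 0) (add_dioph (hb 2) h1)) (mul_dioph (hb 1) (add_dioph (ha 2) h1)))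
    (add_dioph (mul_dioph (hb 0) (add_dioph (ha 2) h1)) (mul_dioph (ha 1) (add_dioph (hb 2) h1)))

theorem of_isDiophantine_rat {ι : Type} [Fintype ι] {A : Set (ι → ℚ)} (hA : IsDiophantine ℚ ι A)
    {g : ι → Fin 3 → (α → ℕ) → ℕ} (hg : ∀ j e, DiophFn (g j e)) :
    Dioph {v | (fun j => ratOfNats fun e => g j e v) ∈ A} := by
  obtain ⟨m, p, hp⟩ := hA
  obtain ⟨F, G, H, hF, hG, -, h0, h⟩ := p.exists_isNatPoly_div
  let g' : (ι ⊕ Fin m) × Fin 3 → (α ⊕ Fin m × Fin 3 → ℕ) → ℕ := fun j w =>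
    j.1.elim (fun i => g i j.2 (w ∘ Sum.inl)) fun i => w (Sum.inr (i, j.2))
  have hg' : ∀ j, DiophFn (g' j) := by
    rintro ⟨i | i, e⟩
    · exact reindex_diophFn Sum.inl (hg i e)
    · exact proj_dioph _
  refine ext (ex_dioph (eq_dioph (hF.diophFn_comp hg') (hG.diophFn_comp hg'))) fun v => ?_
  have key : ∀ x : Fin m × Fin 3 → ℕ,
      F (fun i => g' i (Sum.elim v x)) = G (fun i => g' i (Sum.elim v x)) ↔
      MvPolynomial.eval (Sum.elim (fun j => ratOfNats fun e => g j e v)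
        fun i => ratOfNats fun e => x (i, e)) p = 0 := fun x => by
    have h1 := h fun i => g' i (Sum.elim v x)
    have h2 : (fun j => ratOfNats fun e => g' (j, e) (Sum.elim v x)) =
        Sum.elim (fun j => ratOfNats fun e => g j e v) fun i => ratOfNats fun e => x (i, e) := by
      funext j
      rcases j with j | j <;> rfl
    rw [h2] at h1
    have h3 : (H (fun i => g' i (Sum.elim v x)) : ℚ) ≠ 0 := by exact_mod_cast (h0 _).ne'
    rw [h1, div_eq_zero_iff, or_iff_left h3, sub_eq_zero, Nat.cast_inj]
  simp only [Set.mem_ofPred_eq, hp, key]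
  constructor
  · rintro ⟨x, hx⟩
    exact ⟨_, hx⟩
  · rintro ⟨x, hx⟩
    choose y hy using fun i => ratOfNats_surjective (x i)
    refine ⟨fun i => y i.1 i.2, ?_⟩
    simpa only [hy] using hx

end Dioph

theorem Nat.exists_forall_lt_mod_eq (n : ℕ) (h : ℕ → ℕ) :
    ∃ c d : ℕ, ∀ m < n, c % ((m + 1) * d + 1) = h m := by
  let l := (List.range n).map h
  refine ⟨(Nat.unbeta l).unpair.1, (Nat.unbeta l).unpair.2, fun m hm => ?_⟩
  have := Nat.beta_unbeta_coe l ⟨m, by simpa [l] using hm⟩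
  simpa [Nat.beta, l] using this

section Model

variable {k : ℕ}

/-- The image in `(ℚ^k)³` of the graph of a binary operation on `ℤ` under `φ : ℤ → ℚ^k`. -/
def opGraph (φ : ℤ → Fin k → ℚ) (op : ℤ → ℤ → ℤ) : Set (Fin 3 × Fin k → ℚ) :=
  {t | ∃ a b : ℤ, (∀ i, t (0, i) = φ a i) ∧ (∀ i, t (1, i) = φ b i) ∧ ∀ i, t (2, i) = φ (op a b) i}

/-- The point of `(ℚ^k)³` with given components. -/
def blocks (x y z : Fin k → ℚ) : Fin 3 × Fin k → ℚ := fun j => ![x, y, z] j.1 j.2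

variable {φ : ℤ → Fin k → ℚ} {op : ℤ → ℤ → ℤ}

theorem blocks_mem_opGraph {x y z : Fin k → ℚ} : blocks x y z ∈ opGraph φ op ↔
    ∃ a b : ℤ, x = φ a ∧ y = φ b ∧ z = φ (op a b) := by
  simp [opGraph, blocks, funext_iff]

theorem blocks_map_mem_opGraph (hφ : Function.Injective φ) {a b : ℤ} {z : Fin k → ℚ} :
    blocks (φ a) (φ b) z ∈ opGraph φ op ↔ z = φ (op a b) := by
  rw [blocks_mem_opGraph]
  constructor
  · rintro ⟨a', b', ha, hb, rfl⟩
    rw [hφ ha, hφ hb]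
  · rintro rfl
    exact ⟨a, b, rfl, rfl, rfl⟩

theorem Dioph.blocks_dioph {α : Type} {A : Set (Fin 3 × Fin k → ℚ)}
    (hA : IsDiophantine ℚ (Fin 3 × Fin k) A) {x y z : Fin k → Fin 3 → (α → ℕ) → ℕ}
    (hx : ∀ i e, DiophFn (x i e)) (hy : ∀ i e, DiophFn (y i e)) (hz : ∀ i e, DiophFn (z i e)) :
    Dioph {v | blocks (fun i => ratOfNats fun e => x i e v) (fun i => ratOfNats fun e => y i e v)
      (fun i => ratOfNats fun e => z i e v) ∈ A} := by
  refine ext (of_isDiophantine_rat hA (g := fun j => ![x, y, z] j.1 j.2) ?_) fun v => ?_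
  · rintro ⟨j, i⟩ e
    fin_cases j
    exacts [hx i e, hy i e, hz i e]
  · refine iff_of_eq (congrArg (· ∈ A) ?_)
    funext ⟨j, i⟩
    fin_cases j <;> rfl

/-- The set of indices `n ∈ ℕ` at which the sequence `n ↦ φ n i₀`, restricted to its values
below `L`, takes a value larger than all previous ones. -/
def recordSet (φ : ℤ → Fin k → ℚ) (i₀ : Fin k) (L : ℚ) : Set ℕ :=
  {n | φ n i₀ < L ∧ ∀ m : ℕ, m < n → φ m i₀ < L → φ m i₀ < φ n i₀}

theorem recordSet_dioph (hφ : Function.Injective φ)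
    (hA : IsDiophantine ℚ (Fin 3 × Fin k) (opGraph φ (· + ·))) (i₀ : Fin k) (L : ℚ) :
    Dioph {v : Unit → ℕ | v () ∈ recordSet φ i₀ L} := by
  obtain ⟨l, hl⟩ := ratOfNats_surjective L
  choose c hc using fun (n : ℤ) i => ratOfNats_surjective (φ n i)
  have hc' : ∀ n, (fun i => ratOfNats fun e => c n i e) = φ n := fun n => funext (hc n)
  let β : Type := (Fin k × Fin 3) × Bool
  let D : (Unit ⊕ β → ℕ) → ℕ → Fin k → Fin 3 → ℕ := fun w m i e =>
    w (Sum.inr ((i, e), false)) % ((m + 1) * w (Sum.inr ((i, e), true)) + 1)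
  let R : (Unit ⊕ β → ℕ) → ℕ → Fin k → ℚ := fun w m i => ratOfNats (D w m i)
  have hD : ∀ {γ : Type} (f : Unit ⊕ β → γ) {m : (γ → ℕ) → ℕ}, Dioph.DiophFn m →
      ∀ i e, Dioph.DiophFn fun w => D (w ∘ f) (m w) i e := fun f m hm i e =>
    Dioph.mod_dioph (Dioph.proj_dioph _) (Dioph.add_dioph (Dioph.mul_dioph
      (Dioph.add_dioph hm (Dioph.const_dioph 1)) (Dioph.proj_dioph _)) (Dioph.const_dioph 1))
  have hC : ∀ {γ : Type} (n : ℤ) i e, Dioph.DiophFn fun _ : γ → ℕ => c n i e :=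
    fun n i e => Dioph.const_dioph (c n i e)
  have hL : ∀ {γ : Type} e, Dioph.DiophFn fun _ : γ → ℕ => l e := fun e => Dioph.const_dioph (l e)
  have h1 : Dioph {w | blocks (φ 0) (φ 0) (R w 0) ∈ opGraph φ (· + ·)} := by
    have h := Dioph.blocks_dioph hA (hC 0) (hC 0) (hD id (Dioph.const_dioph 0))
    simp only [hc'] at h
    exact h
  have h2 : Dioph {w | R w (w (Sum.inl ())) i₀ < L} := by
    have h := Dioph.ratOfNats_lt_dioph (hD id (Dioph.proj_dioph (Sum.inl ())) i₀) hL
    simp only [hl] at h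
    exact h
  have hn := Dioph.proj_dioph (none : Option (Unit ⊕ β))
  have h3 : Dioph {w : Option (Unit ⊕ β) → ℕ |
      blocks (R (w ∘ some) (w none)) (φ 1) (R (w ∘ some) (w none + 1)) ∈ opGraph φ (· + ·)} := by
    have h := Dioph.blocks_dioph hA (hD some hn) (hC 1)
      (hD some (Dioph.add_dioph hn (Dioph.const_dioph 1)))
    simp only [hc'] at h
    exact h
  have h4 : Dioph {w : Option (Unit ⊕ β) → ℕ | L ≤ R (w ∘ some) (w none) i₀} := by
    simpa only [hl] using Dioph.ratOfNats_le_dioph hL (hD some hn i₀)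
  have h5 : Dioph {w : Option (Unit ⊕ β) → ℕ | R (w ∘ some) (w none) i₀ <
      R (w ∘ some) (w (some (Sum.inl ()))) i₀} :=
    Dioph.ratOfNats_lt_dioph (hD some hn i₀) (hD some (Dioph.proj_dioph (some (Sum.inl ()))) i₀)
  refine Dioph.ext (Dioph.ex_dioph (h1.inter (h2.inter (Dioph.setOf_forall_lt_dioph
    (h3.inter (h4.union h5)) (Dioph.proj_dioph (Sum.inl ())))))) fun v => ?_
  have hR : ∀ w, R w 0 = φ 0 → (∀ m < v (), blocks (R w m) (φ 1) (R w (m + 1)) ∈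
      opGraph φ (· + ·)) → ∀ m ≤ v (), R w m = φ m := fun w h0 hstep m => by
    induction m with
    | zero => exact fun _ => h0
    | succ m ih =>
      intro hm
      have h := hstep m hm
      rw [ih (by omega), blocks_map_mem_opGraph hφ] at h
      exact_mod_cast h
  constructor
  · rintro ⟨t, ht1, ht2, ht3⟩
    have ht0 : R (Sum.elim v t) 0 = φ 0 := by
      simpa using (blocks_map_mem_opGraph hφ).1 ht1
    have hRv := hR _ ht0 fun m hm => (ht3 m hm).1
    refine ⟨by simpa [← hRv (v ()) le_rfl] using ht2, fun m hm hmL => ?_⟩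
    rw [← hRv _ hm.le] at hmL ⊢
    rw [← hRv _ le_rfl]
    exact (ht3 m hm).2.resolve_left hmL.not_ge
  · rintro ⟨hv1, hv2⟩
    choose a b hab using fun i e => Nat.exists_forall_lt_mod_eq (v () + 1) fun m => c m i e
    let t : β → ℕ := fun j => if j.2 then b j.1.1 j.1.2 else a j.1.1 j.1.2
    have hRv : ∀ m ≤ v (), R (Sum.elim v t) m = φ m := fun m hm => by
      funext i
      rw [← hc]
      exact congrArg ratOfNats (funext fun e => hab i e m (by omega))
    refine ⟨t, ?_, ?_, fun m hm => ⟨?_, ?_⟩⟩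
    · change blocks (φ 0) (φ 0) (R (Sum.elim v t) 0) ∈ opGraph φ (· + ·)
      rw [hRv 0 (Nat.zero_le _), blocks_map_mem_opGraph hφ]
      simp
    · change R (Sum.elim v t) (v ()) i₀ < L
      rw [hRv _ le_rfl]
      exact hv1
    · change blocks (R (Sum.elim v t) m) (φ 1) (R (Sum.elim v t) (m + 1)) ∈
        opGraph φ (· + ·)
      replace hm : m < v () := hm
      rw [hRv _ hm.le, hRv _ hm, blocks_map_mem_opGraph hφ]
      simp
    · change L ≤ R (Sum.elim v t) m i₀ ∨ R (Sum.elim v t) m i₀ < R (Sum.elim v t) (v ()) i₀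
      replace hm : m < v () := hm
      rw [hRv _ hm.le, hRv _ le_rfl]
      exact (le_or_gt L (φ m i₀)).imp_right (hv2 m hm)

/-- A set of families of points of `ℚ^k` indexed by `γ` that is the projection of the zero set of
a polynomial over `ℚ`. -/
def BlockDioph {γ : Type} (R : Set (γ → Fin k → ℚ)) : Prop :=
  ∃ (κ : Type) (_ : Finite κ) (p : MvPolynomial ((γ × Fin k) ⊕ κ) ℚ),
    ∀ t, t ∈ R ↔ ∃ x, MvPolynomial.eval (Sum.elim (fun j => t j.1 j.2) x) p = 0

namespace BlockDioph

variable {γ δ : Type}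

theorem inter {R S : Set (γ → Fin k → ℚ)} (hR : BlockDioph R) (hS : BlockDioph S) :
    BlockDioph (R ∩ S) := by
  obtain ⟨κ, _, p, hp⟩ := hR
  obtain ⟨κ', _, q, hq⟩ := hS
  refine ⟨κ ⊕ κ', inferInstance, MvPolynomial.rename (Sum.map id Sum.inl) p ^ 2 +
    MvPolynomial.rename (Sum.map id Sum.inr) q ^ 2, fun t => ?_⟩
  have h : ∀ a b : ℚ, a ^ 2 + b ^ 2 = 0 ↔ a = 0 ∧ b = 0 := fun a b => by
    rw [add_eq_zero_iff_of_nonneg (sq_nonneg a) (sq_nonneg b), sq_eq_zero_iff, sq_eq_zero_iff]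
  simp only [Set.mem_inter_iff, hp, hq, map_add, map_pow, MvPolynomial.eval_rename,
    Sum.elim_comp_map, Function.comp_id, h]
  constructor
  · rintro ⟨⟨x, hx⟩, y, hy⟩
    exact ⟨Sum.elim x y, by simpa using hx, by simpa using hy⟩
  · rintro ⟨x, hx, hy⟩
    exact ⟨⟨_, hx⟩, _, hy⟩

theorem comap {R : Set (γ → Fin k → ℚ)} (hR : BlockDioph R) (f : γ → δ) :
    BlockDioph {t : δ → Fin k → ℚ | t ∘ f ∈ R} := by
  obtain ⟨κ, _, p, hp⟩ := hR
  refine ⟨κ, inferInstance, MvPolynomial.rename (Sum.map (Prod.map f id) id) p, fun t => ?_⟩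
  simp only [Set.mem_ofPred_eq, hp, MvPolynomial.eval_rename, Sum.elim_comp_map]
  rfl

theorem exists_blocks [Finite δ] {R : Set (γ ⊕ δ → Fin k → ℚ)} (hR : BlockDioph R) :
    BlockDioph {t | ∃ y, Sum.elim t y ∈ R} := by
  obtain ⟨κ, _, p, hp⟩ := hR
  let f : ((γ ⊕ δ) × Fin k) ⊕ κ → (γ × Fin k) ⊕ ((δ × Fin k) ⊕ κ) :=
    Sum.elim (fun j => j.1.elim (fun g => Sum.inl (g, j.2)) fun d => Sum.inr (Sum.inl (d, j.2)))
      fun i => Sum.inr (Sum.inr i)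
  have hf : ∀ (t : γ → Fin k → ℚ) (y : δ → Fin k → ℚ) (x : κ → ℚ),
      Sum.elim (fun j => t j.1 j.2) (Sum.elim (fun j => y j.1 j.2) x) ∘ f =
        Sum.elim (fun j => (Sum.elim t y : γ ⊕ δ → Fin k → ℚ) j.1 j.2) x := fun t y x => by
    funext i
    rcases i with ⟨i | i, j⟩ | i <;> rfl
  refine ⟨(δ × Fin k) ⊕ κ, inferInstance, MvPolynomial.rename f p, fun t => ?_⟩
  simp only [Set.mem_ofPred_eq, hp, MvPolynomial.eval_rename, ← hf]
  constructor
  · rintro ⟨y, x, hx⟩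
    exact ⟨_, hx⟩
  · rintro ⟨x, hx⟩
    refine ⟨fun d i => x (Sum.inl (d, i)), fun i => x (Sum.inr i), ?_⟩
    convert! hx
    funext i
    rcases i with i | i <;> rfl

theorem forall_finite {ι : Type} [Finite ι] {R : ι → Set (γ → Fin k → ℚ)}
    (hR : ∀ i, BlockDioph (R i)) : BlockDioph {t | ∀ i, t ∈ R i} := by
  classical
  have := Fintype.ofFinite ι
  choose κ _ p hp using hR
  let f : ∀ i, (γ × Fin k) ⊕ κ i → (γ × Fin k) ⊕ Σ i, κ i := fun i => Sum.map id (Sigma.mk i)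
  refine ⟨Σ i, κ i, inferInstance, ∑ i, MvPolynomial.rename (f i) (p i) ^ 2, fun t => ?_⟩
  simp only [Set.mem_ofPred_eq, hp, map_sum, map_pow, MvPolynomial.eval_rename, f,
    Sum.elim_comp_map, Function.comp_id,
    Finset.sum_eq_zero_iff_of_nonneg fun i _ => sq_nonneg _, Finset.mem_univ, true_imp_iff,
    pow_eq_zero_iff two_ne_zero]
  constructor
  · intro h
    choose x hx using h
    exact ⟨fun j => x j.1 j.2, hx⟩
  · rintro ⟨x, hx⟩ i
    exact ⟨_, hx i⟩

theorem of_eval (p : MvPolynomial (γ × Fin k) ℚ) :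
    BlockDioph {t : γ → Fin k → ℚ | MvPolynomial.eval (fun j => t j.1 j.2) p = 0} :=
  ⟨Empty, inferInstance, MvPolynomial.rename Sum.inl p, fun t => by
    simp [MvPolynomial.eval_rename]⟩

theorem setOf_eq (a b : γ) : BlockDioph {t : γ → Fin k → ℚ | t a = t b} := by
  convert! forall_finite fun i : Fin k => of_eval (γ := γ)
    (MvPolynomial.X (a, i) - MvPolynomial.X (b, i)) using 3 with t
  simp only [Set.mem_ofPred_eq, map_sub, MvPolynomial.eval_X, sub_eq_zero, funext_iff]

theorem setOf_eq_const (a : γ) (c : Fin k → ℚ) : BlockDioph {t : γ → Fin k → ℚ | t a = c} := by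
  convert! forall_finite fun i : Fin k => of_eval (γ := γ)
    (MvPolynomial.X (a, i) - MvPolynomial.C (c i)) using 3 with t
  simp only [Set.mem_ofPred_eq, map_sub, MvPolynomial.eval_X, MvPolynomial.eval_C, sub_eq_zero,
    funext_iff]

theorem of_isDiophantine {A : Set (Fin 3 × Fin k → ℚ)}
    (hA : IsDiophantine ℚ (Fin 3 × Fin k) A) (a b c : γ) :
    BlockDioph {t : γ → Fin k → ℚ | blocks (t a) (t b) (t c) ∈ A} := by
  obtain ⟨m, p, hp⟩ := hA
  have h : BlockDioph {t : Fin 3 → Fin k → ℚ | (fun j => t j.1 j.2) ∈ A} :=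
    ⟨Fin m, inferInstance, p, fun t => hp _⟩
  convert! h.comap ![a, b, c] using 3 with t
  refine iff_of_eq (congrArg (· ∈ A) ?_)
  funext ⟨j, i⟩
  fin_cases j <;> rfl

end BlockDioph

/-- The function `F` is represented, in the model of `ℤ` given by `φ`, by a Diophantine set. -/
def IsRepresentable (φ : ℤ → Fin k → ℚ) {γ : Type} (F : (γ → ℤ) → ℤ) : Prop :=
  ∃ R : Set (Option γ → Fin k → ℚ), BlockDioph R ∧
    ∀ (v : γ → ℤ) (y : Fin k → ℚ), Option.elim' y (fun g => φ (v g)) ∈ R ↔ y = φ (F v)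

namespace IsRepresentable

variable {γ : Type}

theorem proj (g : γ) : IsRepresentable φ fun v : γ → ℤ => v g :=
  ⟨_, .setOf_eq none (some g), fun _ _ => Iff.rfl⟩

theorem const (n : ℤ) : IsRepresentable φ fun _ : γ → ℤ => n :=
  ⟨_, .setOf_eq_const none (φ n), fun _ _ => Iff.rfl⟩

theorem binop (hφ : Function.Injective φ)
    (hop : IsDiophantine ℚ (Fin 3 × Fin k) (opGraph φ op)) {F G : (γ → ℤ) → ℤ}
    (hF : IsRepresentable φ F) (hG : IsRepresentable φ G) :
    IsRepresentable φ fun v => op (F v) (G v) := by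
  obtain ⟨R, hR, hRF⟩ := hF
  obtain ⟨S, hS, hSG⟩ := hG
  let f : Bool → Option γ → Option γ ⊕ Bool := fun b =>
    Option.elim' (Sum.inr b) fun g => Sum.inl (some g)
  have hf : ∀ (v : γ → ℤ) (y : Fin k → ℚ) (x : Bool → Fin k → ℚ) (b : Bool),
      (Sum.elim (Option.elim' y fun g => φ (v g)) x : Option γ ⊕ Bool → Fin k → ℚ) ∘ f b =
        Option.elim' (x b) fun g => φ (v g) := fun v y x b => by
    funext o
    rcases o with _ | g <;> rfl
  refine ⟨_, ((hR.comap (f true)).inter ((hS.comap (f false)).inter (BlockDioph.of_isDiophantine hop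
    (Sum.inr true) (Sum.inr false) (Sum.inl none)))).exists_blocks, fun v y => ?_⟩
  simp only [Set.mem_ofPred_eq, Set.mem_inter_iff, hf, hRF, hSG, Sum.elim_inr, Sum.elim_inl]
  constructor
  · rintro ⟨x, h1, h2, h3⟩
    rw [h1, h2] at h3
    exact (blocks_map_mem_opGraph hφ).1 h3
  · rintro rfl
    exact ⟨fun b => cond b (φ (F v)) (φ (G v)), rfl, rfl, (blocks_map_mem_opGraph hφ).2 rfl⟩

end IsRepresentable

theorem IsNatPoly.isRepresentable (hφ : Function.Injective φ)
    (hA : IsDiophantine ℚ (Fin 3 × Fin k) (opGraph φ (· + ·)))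
    (hM : IsDiophantine ℚ (Fin 3 × Fin k) (opGraph φ (· * ·))) {γ δ : Type} {F : (γ → ℕ) → ℕ}
    (hF : IsNatPoly F) {g : γ → (δ → ℤ) → ℕ}
    (hg : ∀ i, IsRepresentable φ fun w => (g i w : ℤ)) :
    IsRepresentable φ fun w => (F fun i => g i w : ℤ) := by
  induction hF with
  | proj i => exact hg i
  | const n => exact .const n
  | add _ _ h₁ h₂ => simpa using h₁.binop hφ hA h₂
  | mul _ _ h₁ h₂ => simpa using h₁.binop hφ hM h₂

/-- Transfer of Diophantine sets of natural numbers to `ℚ` along a Diophantine model of `ℤ`. -/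
theorem exists_mvPolynomial_of_dioph (hφ : Function.Injective φ)
    (hA : IsDiophantine ℚ (Fin 3 × Fin k) (opGraph φ (· + ·)))
    (hM : IsDiophantine ℚ (Fin 3 × Fin k) (opGraph φ (· * ·))) (i₀ : Fin k) {S : Set ℕ}
    (hS : Dioph {v : Unit → ℕ | v () ∈ S}) :
    ∃ (N : ℕ) (p : MvPolynomial (Fin N) ℚ) (j₀ : Fin N), ∀ q : ℚ,
      (∃ x, MvPolynomial.eval x p = 0 ∧ x j₀ = q) ↔ ∃ n ∈ S, φ (n : ℤ) i₀ = q := by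
  obtain ⟨β, _, F, G, hF, hG, hFG⟩ := hS.exists_isNatPoly
  let δ : Type := (Unit ⊕ β) × Fin 4
  let g : Unit ⊕ β → (δ → ℤ) → ℕ := fun i w => (∑ e, w (i, e) ^ 2).toNat
  have hg' : ∀ i w, (g i w : ℤ) = w (i, 0) * w (i, 0) + w (i, 1) * w (i, 1) +
      (w (i, 2) * w (i, 2) + w (i, 3) * w (i, 3)) := fun i w => by
    rw [Int.toNat_of_nonneg (Finset.sum_nonneg fun _ _ => sq_nonneg _), Fin.sum_univ_four]
    ring
  have hg : ∀ i, IsRepresentable φ fun w => (g i w : ℤ) := fun i => by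
    simp only [hg']
    have h : ∀ e, IsRepresentable φ fun w : δ → ℤ => w (i, e) * w (i, e) := fun e =>
      .binop hφ hM (.proj _) (.proj _)
    exact .binop hφ hA (.binop hφ hA (h 0) (h 1)) (.binop hφ hA (h 2) (h 3))
  have hgs : ∀ n : Unit ⊕ β → ℕ, ∃ w : δ → ℤ, ∀ i, g i w = n i := fun n => by
    choose a b c d h using fun i => Nat.sum_four_squares (n i)
    refine ⟨fun j => ![(a j.1 : ℤ), b j.1, c j.1, d j.1] j.2, fun i => ?_⟩
    have h' := hg' i fun j => ![(a j.1 : ℤ), b j.1, c j.1, d j.1] j.2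
    rw [← Int.natCast_inj, h', ← h]
    simp
    ring
  obtain ⟨R, hR, hRF⟩ := hF.isRepresentable hφ hA hM hg
  obtain ⟨R', hR', hRG⟩ := hG.isRepresentable hφ hA hM hg
  obtain ⟨U, hU, hUn⟩ := hg (Sum.inl ())
  let f : Option δ → Option δ ⊕ Unit := Option.elim' (Sum.inr ()) fun d => Sum.inl (some d)
  have hrange : BlockDioph {t : Option δ → Fin k → ℚ | ∀ d, t (some d) ∈ Set.range φ} := by
    refine BlockDioph.forall_finite (R := fun d => {t | t (some d) ∈ Set.range φ}) fun d => ?_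
    have h := (BlockDioph.of_isDiophantine hA (Sum.inl (some d) : Option δ ⊕ Bool)
      (Sum.inr true) (Sum.inr false)).exists_blocks
    convert! h using 3 with t
    simp only [blocks_mem_opGraph]
    constructor
    · rintro ⟨a, ha⟩
      exact ⟨fun b => cond b (φ 0) (φ (a + 0)), a, 0, ha.symm, rfl, rfl⟩
    · rintro ⟨y, a, b, ha, -⟩
      exact ⟨a, ha.symm⟩
  obtain ⟨κ, _, p, hp⟩ := hrange.inter
    (hU.inter ((hR.comap f).inter (hR'.comap f)).exists_blocks)
  have hmem : ∀ y : Fin k → ℚ, (∃ (t : Option δ → Fin k → ℚ) (x : κ → ℚ),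
      MvPolynomial.eval (Sum.elim (fun j => t j.1 j.2) x) p = 0 ∧ t none = y) ↔
        ∃ n ∈ S, φ (n : ℤ) = y := fun y => by
    have hf : ∀ (w : δ → ℤ) (y : Fin k → ℚ) (z : Unit → Fin k → ℚ),
        (Sum.elim (Option.elim' y fun d => φ (w d)) z : Option δ ⊕ Unit → Fin k → ℚ) ∘ f =
          Option.elim' (z ()) fun d => φ (w d) := fun w y z => by
      funext o
      rcases o with _ | g <;> rfl
    constructor
    · rintro ⟨t, x, hx, rfl⟩
      obtain ⟨ht1, ht2, z, ht3, ht4⟩ := (hp t).2 ⟨x, hx⟩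
      choose w hw using ht1
      have ht : t = Option.elim' (t none) fun d => φ (w d) := by
        funext o
        rcases o with _ | d
        exacts [rfl, (hw d).symm]
      rw [ht] at ht2 ht3 ht4
      simp only [Set.mem_ofPred_eq, hf, hRF, hRG, hUn] at ht2 ht3 ht4
      refine ⟨_, (hFG fun i => g (Sum.inl i) w).2 ⟨fun i => g (Sum.inr i) w, ?_⟩, ht2.symm⟩
      have h := hφ (ht3.symm.trans ht4)
      have hs : Sum.elim (fun i => g (Sum.inl i) w) (fun i => g (Sum.inr i) w) =
          fun i => g i w := Sum.elim_comp_inl_inr fun i => g i w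
      rw [hs]
      exact_mod_cast h
    · rintro ⟨n, hn, rfl⟩
      obtain ⟨t, ht⟩ := (hFG fun _ => n).1 hn
      obtain ⟨w, hw⟩ := hgs (Sum.elim (fun _ => n) t)
      obtain ⟨x, hx⟩ := (hp (Option.elim' (φ n) fun d => φ (w d))).1 (by
        refine ⟨fun d => ⟨w d, rfl⟩, (hUn _ _).2 (by simp only [hw]; rfl),
          fun _ => φ (F fun i => g i w), ?_⟩
        simp only [Set.mem_inter_iff, Set.mem_ofPred_eq, hf, hRF, hRG, true_and]
        simp only [hw]
        exact congrArg _ (congrArg _ ht))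
      exact ⟨_, x, hx, rfl⟩
  obtain ⟨N, ⟨e⟩⟩ := Finite.exists_equiv_fin ((Option δ × Fin k) ⊕ κ)
  refine ⟨N, MvPolynomial.rename e p, e (Sum.inl (none, i₀)), fun q => ?_⟩
  simp only [MvPolynomial.eval_rename]
  constructor
  · rintro ⟨x, hx, rfl⟩
    obtain ⟨n, hn, h⟩ := (hmem fun i => x (e (Sum.inl (none, i)))).1
      ⟨fun o i => x (e (Sum.inl (o, i))), fun i => x (e (Sum.inr i)), by
        convert! hx using 2
        congr 1
        funext i
        rcases i with i | i <;> rfl, rfl⟩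
    exact ⟨n, hn, congrFun h i₀⟩
  · rintro ⟨n, hn, rfl⟩
    obtain ⟨t, x, hx, ht⟩ := (hmem (φ n)).2 ⟨n, hn, rfl⟩
    refine ⟨Sum.elim (fun j => t j.1 j.2) x ∘ e.symm, ?_, ?_⟩
    · simpa [Function.comp_assoc] using hx
    · simp [ht]

end Model

/-- Mazur's conjecture forces the closure of an infinite projection to `ℚ` of a rational variety
to contain an interval. -/
theorem MazurConjecture.exists_Icc_subset_closure (hM : MazurConjecture) {N : ℕ}
    (p : MvPolynomial (Fin N) ℚ) (j : Fin N) {A : Set ℚ}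
    (hA : ∀ q, (∃ x, MvPolynomial.eval x p = 0 ∧ x j = q) ↔ q ∈ A) (hinf : A.Infinite) :
    ∃ x ∈ A, ∃ y ∈ A, x < y ∧ Set.Icc (x : ℝ) y ⊆ closure ((↑) '' A) := by
  have hfin := hM N 1 fun _ => p
  set Z : Set (Fin N → ℝ) := {x | ∃ q : Fin N → ℚ, (∀ i, x i = (q i : ℝ)) ∧
    ∀ _ : Fin 1, MvPolynomial.eval q p = 0}
  have hZ : ∀ a : A, ∃ z : closure Z, z.1 j = (a : ℚ) := fun a => by
    obtain ⟨x, hx, h⟩ := (hA a).2 a.2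
    exact ⟨⟨fun i => x i, subset_closure ⟨x, fun _ => rfl, fun _ => hx⟩⟩,
      congrArg (Rat.cast : ℚ → ℝ) h⟩
  choose z hz using hZ
  have := hinf.to_subtype
  obtain ⟨a, b, hab, h⟩ := Finite.exists_ne_map_eq_of_infinite
    fun a => (z a : ConnectedComponents (closure Z))
  wlog hlt : (a : ℚ) < b generalizing a b
  · exact this b a hab.symm h.symm ((not_lt.1 hlt).lt_of_ne fun h => hab (Subtype.ext h.symm))
  refine ⟨a, a.2, b, b.2, hlt, ?_⟩
  have hcont : Continuous fun w : closure Z => w.1 j :=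
    (continuous_apply j).comp continuous_subtype_val
  have hpre := (isPreconnected_connectedComponent (x := z a)).image _ hcont.continuousOn
  have hmem : z b ∈ connectedComponent (z a) := by
    rw [ConnectedComponents.coe_eq_coe.1 h]
    exact mem_connectedComponent
  have hsub := hpre.Icc_subset ⟨z a, mem_connectedComponent, hz a⟩ ⟨z b, hmem, hz b⟩
  refine hsub.trans ?_
  rintro _ ⟨w, -, rfl⟩
  refine map_mem_closure (f := fun x : Fin N → ℝ => x j) (continuous_apply j) w.2 ?_
  rintro x ⟨q, hq, h0⟩
  exact ⟨q j, (hA _).1 ⟨q, h0 0, rfl⟩, (hq j).symm⟩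

theorem exists_infinite_range_apply {ι κ : Type*} [Infinite ι] [Finite κ] {α : Type*}
    {f : ι → κ → α} (hf : Function.Injective f) : ∃ i, (Set.range fun n => f n i).Infinite := by
  by_contra! h
  exact Set.infinite_range_of_injective hf
    ((Set.Finite.pi' fun i => h i).subset (Set.range_subset_iff.2 fun n i => ⟨n, rfl⟩))

section Model

variable {k : ℕ} {φ : ℤ → Fin k → ℚ}

theorem strictMonoOn_recordSet (i₀ : Fin k) (L : ℚ) :
    StrictMonoOn (fun n : ℕ => φ n i₀) (recordSet φ i₀ L) :=
  fun _ hm _ hn hmn => hn.2 _ hmn hm.1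

theorem recordSet_infinite {i₀ : Fin k} {L : ℚ}
    (hL : ∀ x < L, ∃ n : ℕ, x < φ n i₀ ∧ φ n i₀ < L) : (recordSet φ i₀ L).Infinite := by
  intro hfin
  obtain ⟨x, hxL, hx⟩ : ∃ x < L, ∀ n ∈ recordSet φ i₀ L, φ n i₀ ≤ x := by
    rcases (recordSet φ i₀ L).eq_empty_or_nonempty with h | h
    · exact ⟨L - 1, by linarith, by simp [h]⟩
    · obtain ⟨n, hn, hmax⟩ := hfin.exists_maximalFor (fun n : ℕ => φ n i₀) _ h
      exact ⟨φ n i₀, hn.1, fun m hm => (le_total _ _).elim id fun h => hmax hm h⟩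
  classical
  have h := hL x hxL
  obtain ⟨hx', hL'⟩ := Nat.find_spec h
  refine (hx _ ⟨hL', fun m hm hmL => ?_⟩).not_gt hx'
  exact (not_lt.1 fun hxm => Nat.find_min h hm ⟨hxm, hmL⟩).trans_lt hx'

end Model

theorem StrictMonoOn.not_Icc_subset_closure {f : ℕ → ℚ} {S : Set ℕ} (hf : StrictMonoOn f S)
    {x y : ℚ} (hy : y ∈ f '' S) (hxy : x < y) :
    ¬ Set.Icc (x : ℝ) y ⊆ closure ((↑) '' (f '' S)) := by
  intro h
  obtain ⟨t, ht, rfl⟩ := hy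
  let T : Set ℝ := (fun n => (f n : ℝ)) '' Set.Iio t
  have hT : T.Finite := (Set.finite_Iio t).image _
  refine (Set.Ioo_infinite (Rat.cast_lt (K := ℝ).2 hxy)) (hT.subset fun r hr => ?_)
  rw [← hT.isClosed.closure_eq]
  refine closure_mono ?_ (isOpen_Ioo.inter_closure ⟨hr, h (Set.Ioo_subset_Icc_self hr)⟩)
  rintro _ ⟨hr, _, ⟨n, hn, rfl⟩, rfl⟩
  exact ⟨n, (hf.lt_iff_lt hn ht).1 (by exact_mod_cast hr.2), rfl⟩

/-- (Cornelissen–Zahidi) If Mazur's conjecture holds, then there is no Diophantine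
model of `ℤ` over `ℚ`: there are no `k` and injection `φ : ℤ → ℚ^k` whose images of the
graphs of addition and multiplication are Diophantine over `ℚ`. -/
theorem no_diophantine_model_of_mazur (hM : MazurConjecture) :
    ¬ ∃ (k : ℕ) (φ : ℤ → (Fin k → ℚ)), Function.Injective φ ∧
      IsDiophantine ℚ (Fin 3 × Fin k)
        {t | ∃ a b : ℤ, (∀ i, t (0, i) = φ a i) ∧ (∀ i, t (1, i) = φ b i) ∧
          ∀ i, t (2, i) = φ (a + b) i} ∧
      IsDiophantine ℚ (Fin 3 × Fin k)
        {t | ∃ a b : ℤ, (∀ i, t (0, i) = φ a i) ∧ (∀ i, t (1, i) = φ b i) ∧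
          ∀ i, t (2, i) = φ (a * b) i} := by
  rintro ⟨k, φ, hφ, hA, hB⟩
  have key : ∀ (i₀ : Fin k) {S : Set ℕ}, Dioph {v : Unit → ℕ | v () ∈ S} →
      ((fun n : ℕ => φ n i₀) '' S).Infinite → ∃ x ∈ (fun n : ℕ => φ n i₀) '' S,
        ∃ y ∈ (fun n : ℕ => φ n i₀) '' S, x < y ∧
          Set.Icc (x : ℝ) y ⊆ closure ((↑) '' ((fun n : ℕ => φ n i₀) '' S)) := by
    intro i₀ S hS hinf
    obtain ⟨N, p, j, hp⟩ := exists_mvPolynomial_of_dioph hφ hA hB i₀ hS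
    exact hM.exists_Icc_subset_closure p j hp hinf
  obtain ⟨i₀, hi₀⟩ := exists_infinite_range_apply (hφ.comp Nat.cast_injective)
  obtain ⟨x, -, y, -, hxy, hsub⟩ := key i₀ (S := Set.univ) (Dioph.ext
    (Dioph.eq_dioph (Dioph.const_dioph 0) (Dioph.const_dioph 0)) fun v => by simp)
    (by rwa [Set.image_univ])
  obtain ⟨L, hxL, hLy⟩ := exists_between hxy
  have hL : ∀ z < L, ∃ n : ℕ, z < φ n i₀ ∧ φ n i₀ < L := fun z hz => by
    obtain ⟨r, hr, hrL⟩ := exists_between (max_lt hz hxL)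
    obtain ⟨_, ⟨h1, h2⟩, _, ⟨n, -, rfl⟩, rfl⟩ := mem_closure_iff.1
      (hsub (show (r : ℝ) ∈ Set.Icc (x : ℝ) y from
        ⟨by exact_mod_cast ((le_max_right _ _).trans_lt hr).le,
          by exact_mod_cast (hrL.trans hLy).le⟩)) (Set.Ioo (z : ℝ) L) isOpen_Ioo
      ⟨by exact_mod_cast (le_max_left _ _).trans_lt hr, by exact_mod_cast hrL⟩
    exact ⟨n, by exact_mod_cast h1, by exact_mod_cast h2⟩
  have hmono := strictMonoOn_recordSet (φ := φ) i₀ L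
  obtain ⟨s, -, t, ht, hst, h⟩ := key i₀ (recordSet_dioph hφ hA i₀ L)
    ((recordSet_infinite hL).image hmono.injOn)
  exact hmono.not_Icc_subset_closure ht hst h
end

section
/- (Julia Robinson) The set of integers ℤ, viewed as a subset of ℚ, is first-order definable over ℚ in the language of rings: there exists a first-order formula φ(x) in the language of rings (with one free variable and no parameters) such that for every r ∈ ℚ, the structure ℚ satisfies φ(r) if and only if r ∈ ℤ. -/
open FirstOrder

theorem exists_small_ternary_congruence {a b c : ℕ} (ha : 0 < a) (hb : 0 < b) (hc : 0 < c)
    (α : ZMod a) (β : ZMod b) (κ : ZMod c) :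
    ∃ x y z : ℤ, (x, y, z) ≠ (0, 0, 0) ∧ x ^ 2 ≤ b * c ∧ y ^ 2 ≤ a * c ∧ z ^ 2 ≤ a * b ∧
      (b * y : ZMod a) = α * z ∧ (a * x : ZMod b) = β * z ∧ (a * x : ZMod c) = κ * y := by
  have : NeZero a := ⟨ha.ne'⟩
  have : NeZero b := ⟨hb.ne'⟩
  have : NeZero c := ⟨hc.ne'⟩
  let box : Finset (ℕ × ℕ × ℕ) := Finset.range (Nat.sqrt (b * c) + 1) ×ˢ
    Finset.range (Nat.sqrt (a * c) + 1) ×ˢ Finset.range (Nat.sqrt (a * b) + 1)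
  let f : ℕ × ℕ × ℕ → ZMod a × ZMod b × ZMod c := fun v =>
    (b * v.2.1 - α * v.2.2, a * v.1 - β * v.2.2, a * v.1 - κ * v.2.1)
  have hcard : (Finset.univ : Finset (ZMod a × ZMod b × ZMod c)).card < box.card := by
    simp only [box, Finset.card_product, Finset.card_range, Finset.card_univ, Fintype.card_prod,
      ZMod.card]
    have h1 := Nat.lt_succ_sqrt' (b * c)
    have h2 := Nat.lt_succ_sqrt' (a * c)
    have h3 := Nat.lt_succ_sqrt' (a * b)
    simp only [Nat.succ_eq_add_one] at h1 h2 h3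
    refine lt_of_pow_lt_pow_left₀ 2 (Nat.zero_le _) ?_
    calc (a * (b * c)) ^ 2 = (b * c) * ((a * c) * (a * b)) := by ring
      _ < (Nat.sqrt (b * c) + 1) ^ 2 *
          ((Nat.sqrt (a * c) + 1) ^ 2 * (Nat.sqrt (a * b) + 1) ^ 2) := by gcongr
      _ = _ := by ring
  obtain ⟨⟨x₁, y₁, z₁⟩, h₁, ⟨x₂, y₂, z₂⟩, h₂, hne, hf⟩ :=
    Finset.exists_ne_map_eq_of_card_lt_of_maps_to hcard (f := f) (fun _ _ => Finset.mem_univ _)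
  simp only [box, Finset.mem_product, Finset.mem_range, Nat.lt_succ_iff] at h₁ h₂
  simp only [f, Prod.mk.injEq] at hf
  have bound {u v k : ℕ} (hu : u ≤ Nat.sqrt k) (hv : v ≤ Nat.sqrt k) :
      ((u : ℤ) - v) ^ 2 ≤ k := by
    have hk : (Nat.sqrt k : ℤ) ^ 2 ≤ k := mod_cast Nat.sqrt_le' k
    refine le_trans (sq_le_sq.2 ?_) hk
    rw [abs_le, abs_of_nonneg (by positivity)]
    omega
  refine ⟨x₁ - x₂, y₁ - y₂, z₁ - z₂, ?_, mod_cast bound h₁.1 h₂.1, mod_cast bound h₁.2.1 h₂.2.1,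
    mod_cast bound h₁.2.2 h₂.2.2, ?_, ?_, ?_⟩
  · contrapose! hne
    simp only [Prod.mk.injEq] at hne ⊢
    omega
  · push_cast
    linear_combination hf.1
  · push_cast
    linear_combination hf.2.1
  · push_cast
    linear_combination hf.2.2

/-- A form of Legendre's theorem on ternary quadratic forms. -/
theorem exists_ternary_zero {a b c : ℕ} (ha : 0 < a) (hb : 0 < b) (hc : 0 < c)
    (cab : a.Coprime b) (cac : a.Coprime c) (cbc : b.Coprime c)
    (nab : ¬ IsSquare (a * b)) (nbc : ¬ IsSquare (b * c))
    (sa : IsSquare ((b * c : ℕ) : ZMod a)) (sb : IsSquare ((a * c : ℕ) : ZMod b))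
    (sc : IsSquare ((-(a * b : ℕ) : ℤ) : ZMod c)) :
    ∃ x y z : ℤ, (x, y, z) ≠ (0, 0, 0) ∧ a * x ^ 2 + b * y ^ 2 = c * z ^ 2 := by
  obtain ⟨α, hα⟩ := sa
  obtain ⟨β, hβ⟩ := sb
  obtain ⟨κ, hκ⟩ := sc
  push_cast at hα hβ hκ
  obtain ⟨x, y, z, hne, hx, hy, hz, h1, h2, h3⟩ := exists_small_ternary_congruence ha hb hc α β κ
  have iab : IsCoprime (a : ℤ) b := Nat.isCoprime_iff_coprime.2 cab
  have iac : IsCoprime (a : ℤ) c := Nat.isCoprime_iff_coprime.2 cac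
  have ibc : IsCoprime (b : ℤ) c := Nat.isCoprime_iff_coprime.2 cbc
  have d1 : (a : ℤ) ∣ a * x ^ 2 + b * y ^ 2 - c * z ^ 2 := by
    refine iab.dvd_of_dvd_mul_left ((ZMod.intCast_zmod_eq_zero_iff_dvd _ _).1 ?_)
    push_cast
    rw [ZMod.natCast_self]
    linear_combination (b * y + α * z) * h1 - z ^ 2 * hα
  have d2 : (b : ℤ) ∣ a * x ^ 2 + b * y ^ 2 - c * z ^ 2 := by
    refine iab.symm.dvd_of_dvd_mul_left ((ZMod.intCast_zmod_eq_zero_iff_dvd _ _).1 ?_)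
    push_cast
    rw [ZMod.natCast_self]
    linear_combination (a * x + β * z) * h2 - z ^ 2 * hβ
  have d3 : (c : ℤ) ∣ a * x ^ 2 + b * y ^ 2 - c * z ^ 2 := by
    refine iac.symm.dvd_of_dvd_mul_left ((ZMod.intCast_zmod_eq_zero_iff_dvd _ _).1 ?_)
    push_cast
    rw [ZMod.natCast_self]
    linear_combination (a * x + κ * y) * h3 - y ^ 2 * hκ
  obtain ⟨k, hk⟩ := (iac.mul_left ibc).mul_dvd (iab.mul_dvd d1 d2) d3
  have ha' : (0 : ℤ) < a := mod_cast ha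
  have hb' : (0 : ℤ) < b := mod_cast hb
  have hc' : (0 : ℤ) < c := mod_cast hc
  have natAbs_isSquare {n : ℕ} {t : ℤ} (h : t ^ 2 = n) : IsSquare n :=
    ⟨t.natAbs, by zify; rw [← sq, sq_abs, h]⟩
  have hx' : x ^ 2 < b * c := lt_of_le_of_ne hx fun h => nbc (natAbs_isSquare (mod_cast h))
  have hz' : z ^ 2 < a * b := lt_of_le_of_ne hz fun h => nab (natAbs_isSquare (mod_cast h))
  have habc : (0 : ℤ) < a * b * c := by positivity
  have hk2 : k < 2 := by
    refine lt_of_mul_lt_mul_left ?_ habc.le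
    rw [← hk]
    nlinarith [sq_nonneg z, mul_lt_mul_of_pos_left hx' ha', mul_le_mul_of_nonneg_left hy hb'.le,
      mul_nonneg hc'.le (sq_nonneg z)]
  have hk1 : -1 < k := by
    refine lt_of_mul_lt_mul_left ?_ habc.le
    rw [← hk]
    nlinarith [mul_nonneg ha'.le (sq_nonneg x), mul_nonneg hb'.le (sq_nonneg y),
      mul_lt_mul_of_pos_left hz' hc']
  obtain rfl | rfl : k = 0 ∨ k = 1 := by omega
  · exact ⟨x, y, z, hne, by linarith⟩
  · refine ⟨x * z + b * y, y * z - a * x, z ^ 2 + a * b, ?_, ?_⟩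
    · intro h
      simp only [Prod.mk.injEq] at h
      nlinarith [h.2.2, sq_nonneg z, mul_pos ha' hb']
    · linear_combination (z ^ 2 + a * b) * hk

open NumberTheorySymbols in
theorem coprime_of_jacobiSym_eq_neg_one {a b : ℕ} (h : J(a | b) = -1) : a.Coprime b := by
  by_contra hab
  rcases eq_or_ne b 0 with rfl | hb
  · simp at h
  · rw [jacobiSym.eq_zero_iff.2 ⟨hb, by rwa [Int.gcd_natCast_natCast]⟩] at h
    norm_num at h

open NumberTheorySymbols in
/-- The local conditions at `p`, `e` and `2` that make `s` a value of the norm form of the pure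
quaternions of `(e, p)`. -/
theorem exists_pure_quaternion_norm_eq {p e s : ℕ} (hp : p.Prime) (he : e.Prime) (he8 : e % 8 = 5)
    (hpe : J(p | e) = -1) (hs8 : s % 8 = 5) (hse : J(s | e) = -1)
    (hsp : p ≠ 2 → J(s | p) = -1) :
    ∃ y z w : ℚ, (s : ℚ) = e * y ^ 2 + p * z ^ 2 - e * p * w ^ 2 := by
  have := Fact.mk hp
  have := Fact.mk he
  have s_odd : Odd s := Nat.odd_iff.2 (by omega)
  have cse : s.Coprime e := coprime_of_jacobiSym_eq_neg_one hse
  have cpe : p.Coprime e := coprime_of_jacobiSym_eq_neg_one hpe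
  have csp : s.Coprime p := by
    rcases eq_or_ne p 2 with rfl | h2
    · exact Nat.coprime_two_right.2 s_odd
    · exact coprime_of_jacobiSym_eq_neg_one (hsp h2)
  have cs8 : s.Coprime 8 := Nat.Coprime.pow_right 3 (Nat.coprime_two_right.2 s_odd)
  have cs8ep : s.Coprime (8 * (e * p)) := cs8.mul_right (cse.mul_right csp)
  have hs0 : 0 < s := by omega
  let r := Nat.chineseRemainder cs8ep (e * p) s
  have hr : Nat.Coprime r (s * (8 * (e * p))) := by
    refine Nat.Coprime.mul_right ?_ ?_
    · rw [Nat.Coprime, r.2.1.gcd_eq]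
      exact (cse.mul_right csp).symm
    · rw [Nat.Coprime, r.2.2.gcd_eq]
      exact cs8ep
  obtain ⟨l, hl, hlp, hlr⟩ := Nat.forall_exists_prime_gt_and_modEq (e + p + s)
    (mul_ne_zero hs0.ne' (mul_ne_zero (by norm_num) (mul_ne_zero he.ne_zero hp.ne_zero))) hr
  have := Fact.mk hlp
  have hls : l ≡ e * p [MOD s] := (hlr.of_mul_right _).trans r.2.1
  have hl8ep : l ≡ s [MOD 8 * (e * p)] := (hlr.of_mul_left _).trans r.2.2
  have hl8 : l % 8 = 5 := Eq.trans (hl8ep.of_mul_right (e * p)) hs8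
  have hlep : l ≡ s [MOD e * p] := hl8ep.of_mul_left 8
  have hle : l ≡ s [MOD e] := hlep.of_mul_right _
  have hlp' : l ≡ s [MOD p] := hlep.of_mul_left _
  have jmod {x y n : ℕ} (h : x ≡ y [MOD n]) : J(x | n) = J(y | n) :=
    jacobiSym.mod_left' (mod_cast h)
  have l_odd : Odd l := Nat.odd_iff.2 (by omega)
  have e_odd : Odd e := Nat.odd_iff.2 (by omega)
  have cle {q : ℕ} (hq : q.Prime) (h : q < l) : q.Coprime l :=
    (Nat.coprime_primes hq hlp).2 h.ne
  have cel : e.Coprime l := cle he (by omega)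
  have cpl : p.Coprime l := cle hp (by omega)
  have csl : s.Coprime l := by
    rw [Nat.coprime_comm, Nat.Coprime, hls.gcd_eq]
    exact (cse.mul_right csp).symm
  have J1 : J(-1 | l) = 1 := by
    rw [jacobiSym.at_neg_one l_odd, ZMod.χ₄_nat_one_mod_four (by omega)]
  have Je : J(e | l) = -1 := by
    rw [jacobiSym.quadratic_reciprocity_one_mod_four (by omega) l_odd, jmod hle, hse]
  have J2 {n : ℕ} (hn : n % 8 = 5) : J((2 : ℕ) | n) = -1 := by
    rw [Nat.cast_ofNat, jacobiSym.at_two (Nat.odd_iff.2 (by omega)), ZMod.χ₈_nat_eq_if_mod_eight]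
    simp [hn]
    omega
  have Jp : J(p | l) = -1 := by
    rcases eq_or_ne p 2 with rfl | h2
    · exact J2 hl8
    · rw [jacobiSym.quadratic_reciprocity_one_mod_four' (hp.odd_of_ne_two h2) (by omega),
        jmod hlp', hsp h2]
  have Jes : J(e | s) = -1 := by
    rw [jacobiSym.quadratic_reciprocity_one_mod_four (by omega) s_odd, hse]
  have Jps : J(p | s) = -1 := by
    rcases eq_or_ne p 2 with rfl | h2
    · exact J2 hs8
    · rw [jacobiSym.quadratic_reciprocity_one_mod_four' (hp.odd_of_ne_two h2) (by omega), hsp h2]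
  have Jsl : J(s | l) = 1 := by
    rw [jacobiSym.quadratic_reciprocity_one_mod_four (by omega) l_odd, jmod hls, Nat.cast_mul,
      jacobiSym.mul_left, Jes, Jps]
    norm_num
  have not_sq {m q : ℕ} (hq : q.Prime) (hm : ¬ q ∣ m) : ¬ IsSquare (m * q) := by
    rintro ⟨t, ht⟩
    obtain ⟨u, rfl⟩ : q ∣ t := (hq.dvd_mul.1 (ht ▸ dvd_mul_left q m)).elim id id
    exact hm ⟨u * u, Nat.eq_of_mul_eq_mul_right hq.pos (by rw [ht]; ring)⟩
  have not_dvd {q m : ℕ} (hq : q.Prime) (h : m.Coprime q) : ¬ q ∣ m :=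
    (Nat.Prime.coprime_iff_not_dvd hq).1 h.symm
  obtain ⟨x₁, y₁, t₁, hne₁, h₁⟩ := exists_ternary_zero he.pos hp.pos hlp.pos cpe.symm cel cpl
    (not_sq hp (not_dvd hp cpe.symm)) (not_sq hlp (not_dvd hlp cpl))
    (by
      rw [← Int.cast_natCast]
      refine ZMod.isSquare_of_jacobiSym_eq_one ?_
      rw [Nat.cast_mul, jacobiSym.mul_left, hpe, jmod hle, hse]
      norm_num)
    (by
      rcases eq_or_ne p 2 with rfl | h2
      · generalize ((e * l : ℕ) : ZMod 2) = u
        revert u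
        decide
      · rw [← Int.cast_natCast]
        refine ZMod.isSquare_of_jacobiSym_eq_one ?_
        rw [Nat.cast_mul, jacobiSym.mul_left, jmod hlp', hsp h2,
          jacobiSym.quadratic_reciprocity_one_mod_four (by omega) (hp.odd_of_ne_two h2), hpe]
        norm_num)
    (by
      refine ZMod.isSquare_of_jacobiSym_eq_one ?_
      rw [neg_eq_neg_one_mul, Nat.cast_mul, jacobiSym.mul_left, jacobiSym.mul_left, J1, Je, Jp]
      norm_num)
  obtain ⟨x₂, y₂, t₂, hne₂, h₂⟩ := exists_ternary_zero hs0 (mul_pos he.pos hp.pos) hlp.pos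
    (cse.mul_right csp) csl (cel.mul_left cpl)
    (by
      rw [← mul_assoc]
      exact not_sq hp (not_dvd hp (csp.mul_left cpe.symm)))
    (not_sq hlp (not_dvd hlp (cel.mul_left cpl)))
    (by
      refine ⟨(e * p : ℕ), ?_⟩
      rw [Nat.cast_mul, (ZMod.natCast_eq_natCast_iff _ _ _).2 hls])
    (by
      refine ⟨(s : ℕ), ?_⟩
      rw [Nat.cast_mul, (ZMod.natCast_eq_natCast_iff _ _ _).2 hlep])
    (by
      refine ZMod.isSquare_of_jacobiSym_eq_one ?_
      rw [neg_eq_neg_one_mul, Nat.cast_mul, Nat.cast_mul, jacobiSym.mul_left, jacobiSym.mul_left,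
        jacobiSym.mul_left, J1, Jsl, Je, Jp]
      norm_num)
  have he0 : (0 : ℤ) < e := mod_cast he.pos
  have hp0 : (0 : ℤ) < p := mod_cast hp.pos
  have hl0 : (0 : ℤ) < l := mod_cast hlp.pos
  have ht₁ : t₁ ≠ 0 := by
    rintro rfl
    refine hne₁ ?_
    have hx := mul_nonneg he0.le (sq_nonneg x₁)
    have hy := mul_nonneg hp0.le (sq_nonneg y₁)
    have hx0 : (e : ℤ) * x₁ ^ 2 = 0 := by linarith
    have hy0 : (p : ℤ) * y₁ ^ 2 = 0 := by linarith
    simp_all [he.ne_zero, hp.ne_zero]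
  have hx₂ : x₂ ≠ 0 := by
    rintro rfl
    have hy0 : y₂ ≠ 0 := by
      rintro rfl
      simp_all [hlp.ne_zero]
    refine not_sq hlp (not_dvd hlp (cel.mul_left cpl)) ?_
    rw [← Rat.isSquare_natCast_iff]
    refine ⟨(l * t₂ / y₂ : ℚ), ?_⟩
    have h : ((e * p : ℕ) : ℚ) * y₂ ^ 2 = l * t₂ ^ 2 := by
      have : ((e * p : ℕ) : ℤ) * y₂ ^ 2 = l * t₂ ^ 2 := by linarith
      exact_mod_cast this
    have : (y₂ : ℚ) ≠ 0 := mod_cast hy0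
    push_cast at h ⊢
    field_simp
    linear_combination l * h
  have qt₁ : (t₁ : ℚ) ≠ 0 := mod_cast ht₁
  have qx₂ : (x₂ : ℚ) ≠ 0 := mod_cast hx₂
  have q₁ : (e : ℚ) * x₁ ^ 2 + p * y₁ ^ 2 = l * t₁ ^ 2 := mod_cast h₁
  have q₂ : (s : ℚ) * x₂ ^ 2 + e * p * y₂ ^ 2 = l * t₂ ^ 2 := mod_cast h₂
  refine ⟨x₁ * t₂ / (t₁ * x₂), y₁ * t₂ / (t₁ * x₂), y₂ / x₂, ?_⟩
  field_simp
  linear_combination t₁ ^ 2 * q₂ - t₂ ^ 2 * q₁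

theorem dvd_of_sq_dvd_quaternion_norm {q : ℕ} (hq : q.Prime) {e : ℤ}
    (h : ∀ x y : ℤ, (q : ℤ) ∣ x ^ 2 - e * y ^ 2 → (q : ℤ) ∣ x ∧ (q : ℤ) ∣ y) {a b c f : ℤ}
    (hN : (q : ℤ) ^ 2 ∣ a ^ 2 - e * b ^ 2 - q * (c ^ 2 - e * f ^ 2)) :
    (q : ℤ) ∣ a ∧ (q : ℤ) ∣ b ∧ (q : ℤ) ∣ c ∧ (q : ℤ) ∣ f := by
  obtain ⟨k, hk⟩ := hN
  obtain ⟨⟨a', rfl⟩, ⟨b', rfl⟩⟩ := h a b ⟨q * k + (c ^ 2 - e * f ^ 2), by linear_combination hk⟩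
  have hq0 : (q : ℤ) ≠ 0 := mod_cast hq.ne_zero
  obtain ⟨hc, hf⟩ := h c f ⟨a' ^ 2 - e * b' ^ 2 - k,
    mul_left_cancel₀ hq0 (by linear_combination -hk)⟩
  exact ⟨dvd_mul_right _ _, dvd_mul_right _ _, hc, hf⟩

theorem two_dvd_of_sixteen_dvd_quaternion_norm {e : ℤ} (he : e % 8 = 5) {a b c f : ℤ}
    (hN : 16 ∣ a ^ 2 - e * b ^ 2 - 2 * (c ^ 2 - e * f ^ 2)) :
    2 ∣ a ∧ 2 ∣ b ∧ 2 ∣ c ∧ 2 ∣ f := by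
  have key : ∀ e a b c f : ZMod 16, (e = 5 ∨ e = 13) →
      a ^ 2 - e * b ^ 2 - 2 * (c ^ 2 - e * f ^ 2) = 0 →
        8 * a = 0 ∧ 8 * b = 0 ∧ 8 * c = 0 ∧ 8 * f = 0 := by
    have sq : ∀ a : ZMod 16, (a ^ 2 = 0 ∨ a ^ 2 = 4) ∧ 8 * a = 0 ∨ (a ^ 2 = 1 ∨ a ^ 2 = 9) := by
      decide
    rintro e a b c f (rfl | rfl) h <;>
    rcases sq a with ⟨ha | ha, ha'⟩ | ha | ha <;> rcases sq b with ⟨hb | hb, hb'⟩ | hb | hb <;>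
    rcases sq c with ⟨hc | hc, hc'⟩ | hc | hc <;> rcases sq f with ⟨hf | hf, hf'⟩ | hf | hf <;>
    rw [ha, hb, hc, hf] at h <;> first | exact absurd h (by decide) | exact ⟨ha', hb', hc', hf'⟩
  have he' : (e : ZMod 16) = 5 ∨ (e : ZMod 16) = 13 := by
    have h5 := ZMod.intCast_eq_intCast_iff e 5 16
    have h13 := ZMod.intCast_eq_intCast_iff e 13 16
    push_cast at h5 h13
    rw [h5, h13]
    simp only [Int.ModEq]
    omega
  have h := key e a b c f he' (by
    have := (ZMod.intCast_zmod_eq_zero_iff_dvd _ 16).2 hN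
    push_cast at this
    exact this)
  have even_of {x : ℤ} (hx : (8 : ZMod 16) * x = 0) : 2 ∣ x := by
    have : ((8 * x : ℤ) : ZMod 16) = 0 := by
      push_cast
      exact hx
    have := (ZMod.intCast_zmod_eq_zero_iff_dvd _ 16).1 this
    omega
  exact ⟨even_of h.1, even_of h.2.1, even_of h.2.2.1, even_of h.2.2.2⟩

/-- The quaternion norm form of `(e, q)` is anisotropic at `q`, with a loss of precision that is
only needed for `q = 2`. -/
def AnisotropicAt (q : ℕ) (e : ℤ) : Prop :=
  ∀ a b c f : ℤ, (q : ℤ) ^ 4 ∣ a ^ 2 - e * b ^ 2 - q * (c ^ 2 - e * f ^ 2) →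
    (q : ℤ) ∣ a ∧ (q : ℤ) ∣ b ∧ (q : ℤ) ∣ c ∧ (q : ℤ) ∣ f

open NumberTheorySymbols in
theorem anisotropicAt_of_jacobiSym {q : ℕ} (hq : q.Prime) {e : ℤ} (h : J(e | q) = -1) :
    AnisotropicAt q e := fun _ _ _ _ hN =>
  have := Fact.mk hq
  dvd_of_sq_dvd_quaternion_norm hq (fun _ _ => jacobiSym.prime_dvd_of_eq_neg_one h)
    ((pow_dvd_pow _ (by norm_num)).trans hN)

theorem anisotropicAt_two {e : ℤ} (he : e % 8 = 5) : AnisotropicAt 2 e := fun _ _ _ _ hN => by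
  push_cast at hN ⊢
  exact two_dvd_of_sixteen_dvd_quaternion_norm he hN

theorem AnisotropicAt.exists_sq_not_dvd_denominator {q : ℕ} (hq : q.Prime) {e : ℤ}
    (h : AnisotropicAt q e) (k : ℤ) (d : ℕ) (hd : 0 < d) (a b c f : ℤ)
    (hN : a ^ 2 - e * b ^ 2 - q * (c ^ 2 - e * f ^ 2) = k * d ^ 2) :
    ∃ d' : ℕ, 0 < d' ∧ ¬ q ^ 2 ∣ d' ∧ ∃ a' : ℤ, a * d' = a' * d := by
  induction d using Nat.strong_induction_on generalizing a b c f with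
  | _ d ih =>
    by_cases hqd : q ^ 2 ∣ d
    · obtain ⟨d₂, rfl⟩ := hqd
      obtain ⟨⟨a, rfl⟩, ⟨b, rfl⟩, ⟨c, rfl⟩, ⟨f, rfl⟩⟩ := h a b c f
        ⟨k * d₂ ^ 2, by rw [hN]; push_cast; ring⟩
      have hq0 : (q : ℤ) ≠ 0 := mod_cast hq.ne_zero
      have hd₂ : 0 < q * d₂ := by
        have := hq.pos
        have : 0 < d₂ := Nat.pos_of_mul_pos_left hd
        positivity
      obtain ⟨d', hd', hqd', a', ha'⟩ := ih (q * d₂)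
        (by rw [sq, mul_assoc]; exact lt_mul_of_one_lt_left hd₂ hq.one_lt) hd₂ a b c f
        (mul_left_cancel₀ (pow_ne_zero 2 hq0) (by
          push_cast at hN ⊢
          linear_combination hN))
      refine ⟨d', hd', hqd', a', ?_⟩
      push_cast at ha' ⊢
      linear_combination q * ha'
    · exact ⟨d, hd, hqd, a, rfl⟩

theorem AnisotropicAt.exists_denominator {q : ℕ} (hq : q.Prime) {e : ℤ}
    (h : AnisotropicAt q e) {k : ℤ} {r x y z : ℚ}
    (hN : r ^ 2 - e * x ^ 2 - q * (y ^ 2 - e * z ^ 2) = k) :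
    ∃ d : ℕ, 0 < d ∧ ¬ q ^ 2 ∣ d ∧ ∃ a : ℤ, r * d = a := by
  have clear (u : ℚ) (m : ℕ) : ∃ a : ℤ, (a : ℚ) = u * (u.den * m) :=
    ⟨u.num * m, by push_cast; rw [← mul_assoc, Rat.mul_den_eq_num]⟩
  let d := r.den * (x.den * (y.den * z.den))
  have hd : 0 < d := by positivity
  obtain ⟨a, ha⟩ : ∃ a : ℤ, (a : ℚ) = r * d := by
    simpa [d] using clear r (x.den * (y.den * z.den))
  obtain ⟨b, hb⟩ : ∃ a : ℤ, (a : ℚ) = x * d := by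
    obtain ⟨b, hb⟩ := clear x (r.den * (y.den * z.den))
    exact ⟨b, by rw [hb]; simp only [d]; push_cast; ring⟩
  obtain ⟨c, hc⟩ : ∃ a : ℤ, (a : ℚ) = y * d := by
    obtain ⟨c, hc⟩ := clear y (r.den * (x.den * z.den))
    exact ⟨c, by rw [hc]; simp only [d]; push_cast; ring⟩
  obtain ⟨f, hf⟩ : ∃ a : ℤ, (a : ℚ) = z * d := by
    obtain ⟨f, hf⟩ := clear z (r.den * (x.den * y.den))
    exact ⟨f, by rw [hf]; simp only [d]; push_cast; ring⟩
  obtain ⟨d', hd', hqd', a', ha'⟩ := h.exists_sq_not_dvd_denominator hq k d hd a b c f (by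
    have : (a ^ 2 - e * b ^ 2 - q * (c ^ 2 - e * f ^ 2) : ℚ) = k * d ^ 2 := by
      rw [ha, hb, hc, hf]
      linear_combination d ^ 2 * hN
    exact_mod_cast this)
  refine ⟨d', hd', hqd', a', ?_⟩
  have hd0 : (d : ℚ) ≠ 0 := mod_cast hd.ne'
  refine mul_right_cancel₀ hd0 ?_
  have : (a * d' : ℚ) = a' * d := mod_cast ha'
  linear_combination this - d' * ha

theorem not_dvd_den_of_mul_pow_five {q n d : ℕ} (hq : q.Prime) (hn : ¬ q ^ 4 ∣ n)
    (hd : ¬ q ^ 2 ∣ d) {m : ℚ} {a : ℤ} (h : n * m ^ 5 * d = a) : ¬ q ∣ m.den := by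
  have := Fact.mk hq
  intro hqm
  have hn0 : n ≠ 0 := by rintro rfl; simp at hn
  have hd0 : d ≠ 0 := by rintro rfl; simp at hd
  have hZ : ((n * d : ℕ) : ℤ) * m.num ^ 5 = a * (m.den : ℤ) ^ 5 := by
    have hm := Rat.mul_den_eq_num m
    have : ((n * d : ℕ) : ℚ) * m.num ^ 5 = a * (m.den : ℚ) ^ 5 := by
      rw [← hm, ← h]
      push_cast
      ring
    exact_mod_cast this
  have hdvd : m.den ^ 5 ∣ n * d := by
    have hco : IsCoprime ((m.den : ℤ) ^ 5) (m.num ^ 5) :=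
      (Rat.isCoprime_num_den m).symm.pow
    have := hco.dvd_of_dvd_mul_right (Dvd.intro_left a hZ.symm)
    exact_mod_cast this
  have h5 : q ^ 5 ∣ n * d := (pow_dvd_pow_of_dvd hqm 5).trans hdvd
  rw [padicValNat_dvd_iff_le (mul_ne_zero hn0 hd0), padicValNat.mul hn0 hd0] at h5
  rw [padicValNat_dvd_iff_le hn0] at hn
  rw [padicValNat_dvd_iff_le hd0] at hd
  omega

/-- The polynomial relation which defines a semilocal subring of `ℚ` for suitable `p` and `e`. -/
def IsRepresented (p e m : ℚ) : Prop :=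
  ∃ y z w : ℚ, (4 * p * e * m ^ 5) ^ 2 + (16 * p + e) = e * y ^ 2 + p * z ^ 2 - e * p * w ^ 2

open NumberTheorySymbols in
/-- Pairs of primes such that the quaternion algebra `(e, p)` ramifies exactly at `p` and `e`. -/
structure IsRamifiedPair (p e : ℕ) : Prop where
  prime_left : p.Prime
  prime_right : e.Prime
  mod_eight : e % 8 = 5
  jacobiSym_eq : J(p | e) = -1

namespace IsRamifiedPair

open NumberTheorySymbols

variable {p e : ℕ}

theorem jacobiSym_swap (h : IsRamifiedPair p e) (h2 : p ≠ 2) : J(e | p) = -1 := by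
  have := h.mod_eight
  rw [jacobiSym.quadratic_reciprocity_one_mod_four (by omega) (h.prime_left.odd_of_ne_two h2),
    h.jacobiSym_eq]

theorem coprime (h : IsRamifiedPair p e) : p.Coprime e :=
  coprime_of_jacobiSym_eq_neg_one h.jacobiSym_eq

theorem not_dvd_den_left (h : IsRamifiedPair p e) {m : ℚ} (hm : IsRepresented p e m) :
    ¬ p ∣ m.den := by
  obtain ⟨y, z, w, hN⟩ := hm
  have haniso : AnisotropicAt p e := by
    rcases eq_or_ne p 2 with rfl | h2
    · exact anisotropicAt_two (mod_cast h.mod_eight)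
    · exact anisotropicAt_of_jacobiSym h.prime_left (h.jacobiSym_swap h2)
  obtain ⟨d, -, hpd, a, ha⟩ := haniso.exists_denominator h.prime_left
    (k := -(16 * p + e)) (r := (4 * p * e : ℕ) * m ^ 5) (x := y) (y := z) (z := w)
    (by push_cast; linear_combination hN)
  refine not_dvd_den_of_mul_pow_five h.prime_left ?_ hpd ha
  intro hdvd
  have hdvd' : p * p ^ 3 ∣ p * (4 * e) := by
    convert hdvd using 1 <;> ring
  have h3 := (h.coprime.pow_left 3).dvd_of_dvd_mul_right
    (Nat.dvd_of_mul_dvd_mul_left h.prime_left.pos hdvd')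
  have hp2 := h.prime_left.two_le
  have := Nat.le_of_dvd (by norm_num) h3
  have := Nat.pow_le_pow_left hp2 3
  omega

theorem not_dvd_den_right (h : IsRamifiedPair p e) {m : ℚ} (hm : IsRepresented p e m) :
    ¬ e ∣ m.den := by
  obtain ⟨y, z, w, hN⟩ := hm
  obtain ⟨d, -, hed, a, ha⟩ :=
    (anisotropicAt_of_jacobiSym h.prime_right h.jacobiSym_eq).exists_denominator h.prime_right
    (k := -(16 * p + e)) (r := (4 * p * e : ℕ) * m ^ 5) (x := z) (y := y) (z := w)
    (by push_cast; linear_combination hN)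
  refine not_dvd_den_of_mul_pow_five h.prime_right ?_ hed ha
  intro hdvd
  have hdvd' : e * e ^ 3 ∣ e * (4 * p) := by
    convert hdvd using 1 <;> ring
  have h3 := (h.coprime.symm.pow_left 3).dvd_of_dvd_mul_right
    (Nat.dvd_of_mul_dvd_mul_left h.prime_right.pos hdvd')
  have := Nat.le_of_dvd (by norm_num) h3
  have := Nat.pow_le_pow_left h.prime_right.two_le 3
  omega

theorem isRepresented (h : IsRamifiedPair p e) {m : ℚ} (h2 : ¬ 2 ∣ m.den) (hp : ¬ p ∣ m.den)
    (he : ¬ e ∣ m.den) : IsRepresented p e m := by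
  set u := m.num.natAbs
  set v := m.den
  let s : ℕ := (v ^ 5) ^ 2 * (16 * p + e) + (4 * p * e * u ^ 5) ^ 2
  have he8 := h.mod_eight
  have jsq {a n : ℕ} (ha : a.Coprime n) : J((a ^ 2 : ℕ) | n) = 1 := by
    rw [Nat.cast_pow]
    exact jacobiSym.sq_one' (by rwa [Int.gcd_natCast_natCast])
  have jmod {x y n : ℕ} (h : x ≡ y [MOD n]) : J(x | n) = J(y | n) :=
    jacobiSym.mod_left' (mod_cast h)
  have cv {q : ℕ} (hq : q.Prime) (hqv : ¬ q ∣ v) : v.Coprime q :=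
    ((Nat.Prime.coprime_iff_not_dvd hq).2 hqv).symm
  have e_odd : Odd e := Nat.odd_iff.2 (by omega)
  have hs8 : s % 8 = 5 := by
    have hv : (v ^ 5) ^ 2 % 8 = 1 := by
      have : Odd (v ^ 5) := (Nat.odd_iff.2 (by omega)).pow
      have := Nat.odd_iff.1 this
      have : v ^ 5 % 8 = 1 ∨ v ^ 5 % 8 = 3 ∨ v ^ 5 % 8 = 5 ∨ v ^ 5 % 8 = 7 := by omega
      rcases this with h | h | h | h <;> simp [Nat.pow_mod, h]
    have h1 : (16 * p + e) % 8 = 5 := by omega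
    have h3 : (4 * p * e * u ^ 5) ^ 2 % 8 = 0 :=
      Nat.mod_eq_zero_of_dvd ⟨2 * (p * e * u ^ 5) ^ 2, by ring⟩
    simp only [s]
    rw [Nat.add_mod, Nat.mul_mod, hv, h1, h3]
  have hse : J(s | e) = -1 := by
    have : s ≡ (4 * v ^ 5) ^ 2 * p [MOD e] := by
      rw [← ZMod.natCast_eq_natCast_iff]
      simp only [s]
      push_cast
      rw [ZMod.natCast_self]
      ring
    rw [jmod this, Nat.cast_mul, jacobiSym.mul_left, h.jacobiSym_eq, jsq]
    · norm_num
    · exact Nat.Coprime.mul_left (Nat.Coprime.pow_left 2 (Nat.coprime_two_left.2 e_odd))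
        ((cv h.prime_right he).pow_left 5)
  have hsp (hp2 : p ≠ 2) : J(s | p) = -1 := by
    have : s ≡ (v ^ 5) ^ 2 * e [MOD p] := by
      rw [← ZMod.natCast_eq_natCast_iff]
      simp only [s]
      push_cast
      rw [ZMod.natCast_self]
      ring
    rw [jmod this, Nat.cast_mul, jacobiSym.mul_left, h.jacobiSym_swap hp2,
      jsq ((cv h.prime_left hp).pow_left 5)]
    norm_num
  obtain ⟨y, z, w, hyzw⟩ := exists_pure_quaternion_norm_eq h.prime_left h.prime_right he8
    h.jacobiSym_eq hs8 hse hsp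
  have hv0 : (v : ℚ) ≠ 0 := mod_cast m.den_nz
  refine ⟨y / v ^ 5, z / v ^ 5, w / v ^ 5, ?_⟩
  have hu : (u : ℚ) ^ 2 = (m * v) ^ 2 := by
    rw [Rat.mul_den_eq_num, Nat.cast_natAbs, Int.cast_abs, sq_abs]
  have hu' : ((u : ℚ) ^ 5) ^ 2 = (m ^ 5 * v ^ 5) ^ 2 := by
    linear_combination ((u : ℚ) ^ 8 + u ^ 6 * (m * v) ^ 2 + u ^ 4 * (m * v) ^ 4
      + u ^ 2 * (m * v) ^ 6 + (m * v) ^ 8) * hu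
  simp only [s] at hyzw
  push_cast at hyzw
  field_simp
  linear_combination hyzw - (4 * p * e) ^ 2 * hu'

theorem exists_right (hp : p.Prime) : ∃ e, IsRamifiedPair p e := by
  rcases eq_or_ne p 2 with rfl | h2
  · exact ⟨5, Nat.prime_two, by norm_num, by norm_num, by norm_num⟩
  have := Fact.mk hp
  obtain ⟨a, ha⟩ := FiniteField.exists_nonsquare (F := ZMod p) (by rwa [ZMod.ringChar_zmod_n])
  have ha' : ((a.val : ℕ) : ZMod p) = a := ZMod.natCast_zmod_val a
  have p_odd := hp.odd_of_ne_two h2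
  have c8p : Nat.Coprime 8 p := Nat.Coprime.pow_left 3 (Nat.coprime_two_left.2 p_odd)
  let r := Nat.chineseRemainder c8p 5 a.val
  have hr : Nat.Coprime r (8 * p) := by
    refine Nat.Coprime.mul_right ?_ ?_
    · rw [Nat.Coprime, r.2.1.gcd_eq]
      norm_num
    · rw [Nat.Coprime, r.2.2.gcd_eq]
      refine ((Nat.Prime.coprime_iff_not_dvd hp).2 fun hdvd => ha ?_).symm
      rw [← ha', (ZMod.natCast_eq_zero_iff _ _).2 hdvd]
      exact IsSquare.zero
  obtain ⟨e, -, he, her⟩ := Nat.forall_exists_prime_gt_and_modEq 0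
    (mul_ne_zero (by norm_num) hp.ne_zero) hr
  have he8 : e % 8 = 5 := (her.of_mul_right _).trans r.2.1
  have hea : e ≡ a.val [MOD p] := (her.of_mul_left _).trans r.2.2
  refine ⟨e, hp, he, he8, ?_⟩
  rw [jacobiSym.quadratic_reciprocity_one_mod_four' p_odd (by omega),
    ZMod.nonsquare_iff_jacobiSym_eq_neg_one, Int.cast_natCast,
    (ZMod.natCast_eq_natCast_iff _ _ _).2 hea, ha']
  exact ha

theorem two_five : IsRamifiedPair 2 5 :=
  ⟨Nat.prime_two, by norm_num, by norm_num, by norm_num⟩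

/-- Intersecting with the semilocal ring of the pair `(2, 5)` disposes of the prime `2`. -/
theorem isRepresented_and_iff (h : IsRamifiedPair p e) (m : ℚ) :
    IsRepresented 2 5 m ∧ IsRepresented p e m ↔
      (¬ 2 ∣ m.den ∧ ¬ 5 ∣ m.den) ∧ ¬ p ∣ m.den ∧ ¬ e ∣ m.den := by
  constructor
  · rintro ⟨h25, hpe⟩
    exact ⟨⟨two_five.not_dvd_den_left (mod_cast h25), two_five.not_dvd_den_right (mod_cast h25)⟩,
      h.not_dvd_den_left hpe, h.not_dvd_den_right hpe⟩
  · rintro ⟨⟨h2, h5⟩, hp, he⟩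
    exact ⟨mod_cast two_five.isRepresented h2 h2 h5, h.isRepresented h2 hp he⟩

end IsRamifiedPair

theorem isRepresented_zero (p e : ℚ) : IsRepresented p e 0 := ⟨1, 4, 0, by ring⟩

theorem IsRepresented.neg {p e m : ℚ} (h : IsRepresented p e m) : IsRepresented p e (-m) := by
  obtain ⟨y, z, w, h⟩ := h
  exact ⟨y, z, w, by linear_combination h⟩

/-- The inductive description of `ℤ` inside `ℚ`. -/
theorem exists_int_eq_iff_forall_isRepresented (r : ℚ) :
    (∃ n : ℤ, r = n) ↔ ∀ p e : ℚ,
      (∀ m : ℚ, IsRepresented 2 5 m ∧ IsRepresented p e m →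
        IsRepresented 2 5 (m + 1) ∧ IsRepresented p e (m + 1)) →
      IsRepresented 2 5 r ∧ IsRepresented p e r := by
  constructor
  · rintro ⟨n, rfl⟩ p e hstep
    have hnat (k : ℕ) : IsRepresented 2 5 k ∧ IsRepresented p e k := by
      induction k with
      | zero =>
        rw [Nat.cast_zero]
        exact ⟨isRepresented_zero 2 5, isRepresented_zero p e⟩
      | succ k ih => exact_mod_cast hstep k ih
    obtain ⟨k, rfl | rfl⟩ := n.eq_nat_or_neg
    · exact hnat k
    · push_cast
      exact ⟨(hnat k).1.neg, (hnat k).2.neg⟩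
  · intro h
    by_contra hr
    have hden : r.den ≠ 1 := fun h1 => hr ⟨r.num, (Rat.coe_int_num_of_den_eq_one h1).symm⟩
    obtain ⟨p, hp, hpr⟩ := Nat.exists_prime_and_dvd hden
    obtain ⟨e, hpe⟩ := IsRamifiedPair.exists_right hp
    refine ((hpe.isRepresented_and_iff r).1 (h p e fun m hm => ?_)).2.1 hpr
    rw [hpe.isRepresented_and_iff] at hm ⊢
    have hm1 : (m + 1).den = m.den := mod_cast Rat.add_natCast_den m 1
    rwa [hm1]

section Formula

open Language FreeCommRing

variable {α : Type*} {n : ℕ}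

/-- The formula expressing `IsRepresented p e m`. -/
noncomputable def representedFormula (p e m : FreeCommRing (α ⊕ Fin n)) :
    Language.ring.BoundedFormula α n :=
  let lift (t : FreeCommRing (α ⊕ Fin n)) : FreeCommRing (α ⊕ Fin (n + 3)) :=
    FreeCommRing.map (Sum.map id (Fin.castAdd 3)) t
  let y := of (Sum.inr (Fin.natAdd n 0))
  let z := of (Sum.inr (Fin.natAdd n 1))
  let w := of (Sum.inr (Fin.natAdd n 2))
  ((Ring.termOfFreeCommRing
      ((4 * lift p * lift e * lift m ^ 5) ^ 2 + (16 * lift p + lift e))).bdEqual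
    (Ring.termOfFreeCommRing
      (lift e * y ^ 2 + lift p * z ^ 2 - lift e * lift p * w ^ 2))).ex.ex.ex

theorem realize_representedFormula [Ring.CompatibleRing ℚ] (p e m : FreeCommRing (α ⊕ Fin n))
    (v : α → ℚ) (xs : Fin n → ℚ) :
    (representedFormula p e m).Realize v xs ↔
      IsRepresented (FreeCommRing.lift (Sum.elim v xs) p) (FreeCommRing.lift (Sum.elim v xs) e)
        (FreeCommRing.lift (Sum.elim v xs) m) := by
  have lift_map (y z w : ℚ) (t : FreeCommRing (α ⊕ Fin n)) :
      FreeCommRing.lift (Sum.elim v (Fin.snoc (α := fun _ => ℚ) (Fin.snoc (α := fun _ => ℚ)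
          (Fin.snoc (α := fun _ => ℚ) xs y) z) w))
        (FreeCommRing.map (Sum.map id (Fin.castAdd 3)) t) =
      FreeCommRing.lift (Sum.elim v xs) t := by
    induction t using FreeCommRing.induction_on with
    | neg_one => simp
    | of a =>
      rcases a with a | i
      · simp
      · simp [Fin.snoc, show (i : ℕ) < n + 1 + 1 by omega, show (i : ℕ) < n + 1 by omega]
        rfl
    | add s t hs ht => simp [hs, ht]
    | mul s t hs ht => simp [hs, ht]
  simp [representedFormula, IsRepresented, lift_map, map_ofNat, Fin.snoc]

end Formula

/-- (Julia Robinson) `ℤ`, viewed as a subset of `ℚ`, is first-order definable over `ℚ`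
in the language of rings: there is a first-order ring formula `φ` in one free variable
(without parameters) such that `φ(r)` holds in `ℚ` iff `r` is an integer. -/
theorem int_first_order_definable_over_Q :
    letI := Ring.compatibleRingOfRing ℚ
    ∃ φ : Language.ring.Formula (Fin 1),
      ∀ r : ℚ, φ.Realize (fun _ => r) ↔ ∃ n : ℤ, r = (n : ℚ) := by
  let _ := Ring.compatibleRingOfRing ℚ
  let S {n : ℕ} (m : FreeCommRing (Fin 1 ⊕ Fin (n + 2))) :
      Language.ring.BoundedFormula (Fin 1) (n + 2) :=
    representedFormula 2 5 m ⊓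
      representedFormula (.of (Sum.inr 0)) (.of (Sum.inr 1)) m
  let φ : Language.ring.BoundedFormula (Fin 1) 0 :=
    (((S (.of (Sum.inr 2))).imp (S (n := 1) (.of (Sum.inr 2) + 1))).all.imp
      (S (n := 0) (.of (Sum.inl 0)))).all.all
  refine ⟨φ, fun r => ?_⟩
  rw [exists_int_eq_iff_forall_isRepresented]
  simp [φ, S, Language.Formula.Realize, realize_representedFormula, map_ofNat, Fin.snoc]
end

section
/- (Julia Robinson) For every prime number q, the set Int_q = {x ∈ ℚ : x = a/b with a, b ∈ ℤ and b not divisible by q} (equivalently, the set of rationals whose reduced denominator is not divisible by q) is Diophantine over ℚ. -/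
/-- A case of Legendre's theorem: for coprime nonsquares `a, b > 0`, the equation `z² + b y² = a x²`
has a solution with `x ≠ 0` if `-b` is a square modulo `a` and `a` is a square modulo `b`. -/
theorem exists_sq_add_mul_sq_eq_mul_sq {a b : ℕ} (ha : ¬ IsSquare a) (hb : ¬ IsSquare b)
    (hab : a.Coprime b) {r s : ℤ} (hr : (a : ℤ) ∣ r ^ 2 + b) (hs : (b : ℤ) ∣ s ^ 2 - a) :
    ∃ x y z : ℤ, x ≠ 0 ∧ z ^ 2 + b * y ^ 2 = a * x ^ 2 := by
  have ha0 : 0 < a := Nat.pos_of_ne_zero fun h => ha (h ▸ ⟨0, rfl⟩)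
  have hb0 : 0 < b := Nat.pos_of_ne_zero fun h => hb (h ▸ ⟨0, rfl⟩)
  have : NeZero a := ⟨ha0.ne'⟩
  have : NeZero b := ⟨hb0.ne'⟩
  obtain ⟨⟨x₁, y₁, z₁⟩, ⟨x₂, y₂, z₂⟩, hne, heq⟩ :=
    Fintype.exists_ne_map_eq_of_card_lt
      (fun v : Fin (b.sqrt + 1) × Fin (a.sqrt + 1) × Fin ((a * b).sqrt + 1) =>
        ((((v.2.2 : ℤ) - r * (v.2.1 : ℤ) : ℤ) : ZMod a),
          (((v.2.2 : ℤ) - s * (v.1 : ℤ) : ℤ) : ZMod b))) (by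
      simp only [Fintype.card_prod, ZMod.card, Fintype.card_fin]
      have h1 := Nat.lt_succ_sqrt a
      have h2 := Nat.lt_succ_sqrt b
      have h3 := Nat.lt_succ_sqrt (a * b)
      refine lt_of_pow_lt_pow_left₀ 2 (Nat.zero_le _) ?_
      calc (a * b) ^ 2 = b * a * (a * b) := by ring
        _ < (b.sqrt.succ * b.sqrt.succ) * (a.sqrt.succ * a.sqrt.succ) *
            ((a * b).sqrt.succ * (a * b).sqrt.succ) :=
          mul_lt_mul'' (mul_lt_mul'' h2 h1 (Nat.zero_le _) (Nat.zero_le _)) h3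
            (Nat.zero_le _) (Nat.zero_le _)
        _ = _ := by simp only [Nat.succ_eq_add_one]; ring)
  have key : ∀ (n : ℕ) (u v : Fin (n.sqrt + 1)), ((u : ℤ) - v) ^ 2 ≤ n := by
    intro n u v
    have hu : (u : ℤ) ≤ n.sqrt := by have := u.2; omega
    have hv : (v : ℤ) ≤ n.sqrt := by have := v.2; omega
    have hn : ((n.sqrt * n.sqrt : ℕ) : ℤ) ≤ n := by exact_mod_cast Nat.sqrt_le n
    push_cast at hn
    nlinarith [Int.natCast_nonneg (u : ℕ), Int.natCast_nonneg (v : ℕ)]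
  have hx := key _ x₁ x₂
  have hy := key _ y₁ y₂
  have hz := key _ z₁ z₂
  have hne' : ¬ ((x₁ : ℤ) - x₂ = 0 ∧ (y₁ : ℤ) - y₂ = 0 ∧ (z₁ : ℤ) - z₂ = 0) := by
    rintro ⟨h1, h2, h3⟩
    apply hne
    simp only [Prod.mk.injEq, Fin.ext_iff]
    omega
  simp only [Prod.mk.injEq] at heq
  obtain ⟨e1, e2⟩ := heq
  rw [ZMod.intCast_eq_intCast_iff_dvd_sub] at e1 e2
  generalize hX : (x₁ : ℤ) - x₂ = x at *
  generalize hY : (y₁ : ℤ) - y₂ = y at *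
  generalize hZ : (z₁ : ℤ) - z₂ = z at *
  have d1 : (a : ℤ) ∣ z - r * y := by
    rw [← dvd_neg]
    refine e1.trans (dvd_of_eq ?_)
    linear_combination -hZ + r * hY
  have d2 : (b : ℤ) ∣ z - s * x := by
    rw [← dvd_neg]
    refine e2.trans (dvd_of_eq ?_)
    linear_combination -hZ + s * hX
  have da : (a : ℤ) ∣ z ^ 2 + b * y ^ 2 - a * x ^ 2 := by
    have : z ^ 2 + b * y ^ 2 - a * x ^ 2
        = (z - r * y) * (z + r * y) + (r ^ 2 + b) * y ^ 2 - a * x ^ 2 := by ring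
    rw [this]
    exact dvd_sub (dvd_add (d1.mul_right _) (hr.mul_right _)) (dvd_mul_right _ _)
  have db : (b : ℤ) ∣ z ^ 2 + b * y ^ 2 - a * x ^ 2 := by
    have : z ^ 2 + b * y ^ 2 - a * x ^ 2
        = (z - s * x) * (z + s * x) + (s ^ 2 - a) * x ^ 2 + b * y ^ 2 := by ring
    rw [this]
    exact dvd_add (dvd_add (d2.mul_right _) (hs.mul_right _)) (dvd_mul_right _ _)
  obtain ⟨k, hk⟩ := (Nat.isCoprime_iff_coprime.2 hab).mul_dvd da db
  have hA : (0 : ℤ) < a := by exact_mod_cast ha0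
  have hB : (0 : ℤ) < b := by exact_mod_cast hb0
  have hxlt : x ^ 2 < b := lt_of_le_of_ne hx fun h => hb ⟨x.natAbs, by
    zify; rw [← h, ← sq, sq_abs]⟩
  have hylt : y ^ 2 < a := lt_of_le_of_ne hy fun h => ha ⟨y.natAbs, by
    zify; rw [← h, ← sq, sq_abs]⟩
  push_cast at hz
  have hAB : (0 : ℤ) < a * b := mul_pos hA hB
  have hk1 : k < 2 := by
    by_contra! h
    nlinarith [mul_le_mul_of_nonneg_left h hAB.le, mul_lt_mul_of_pos_left hylt hB,
      mul_nonneg hA.le (sq_nonneg x)]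
  have hk0 : -1 < k := by
    by_contra! h
    nlinarith [mul_le_mul_of_nonneg_left h hAB.le, mul_lt_mul_of_pos_left hxlt hA,
      mul_nonneg hB.le (sq_nonneg y), sq_nonneg z]
  obtain rfl | rfl : k = 0 ∨ k = 1 := by omega
  · refine ⟨x, y, z, ?_, by linarith⟩
    rintro rfl
    have h1 : z ^ 2 = 0 := by nlinarith [sq_nonneg z, mul_nonneg hB.le (sq_nonneg y)]
    have h2 : (b : ℤ) * y ^ 2 = 0 := by nlinarith [sq_nonneg z]
    apply hne'
    refine ⟨rfl, ?_, by simpa using h1⟩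
    rcases mul_eq_zero.1 h2 with h | h
    · exact absurd h hB.ne'
    · simpa using h
  · refine ⟨x ^ 2 + b, z + y * x, z * x - b * y, by positivity, ?_⟩
    linear_combination (x ^ 2 + b) * hk

open NumberTheorySymbols in
/-- A number `C ≡ 1 mod 8`, prime to `qD` and a square modulo `q`, is represented over `ℚ` by the
form `a² + q (b² + D w²)`, where `D ≡ 3 mod 4` is prime. -/
theorem exists_rat_sq_add_mul_norm {C q D : ℕ} (hq : q.Prime) (hD : D.Prime) (hD4 : D % 4 = 3)
    (hC : C % 8 = 1) (hCq : C.Coprime q) (hCD : C.Coprime D) {h : ℤ} (hsq : (q : ℤ) ∣ h ^ 2 - C) :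
    ∃ a b w : ℚ, a ^ 2 + q * (b ^ 2 + D * w ^ 2) = C := by
  by_cases hCs : IsSquare C
  · obtain ⟨c, rfl⟩ := hCs
    exact ⟨c, 0, 0, by push_cast; ring⟩
  have hC0 : C ≠ 0 := by omega
  have hC2 : C.Coprime 2 := by rw [Nat.coprime_comm, Nat.coprime_two_left, Nat.odd_iff]; omega
  have hCodd : Odd C := by rw [Nat.odd_iff]; omega
  have hDodd : Odd D := by rw [Nat.odd_iff]; omega
  have hcop : (4 * D).Coprime C :=
    Nat.Coprime.mul_left (by simpa using (hC2.symm.pow_left 2)) hCD.symm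
  obtain ⟨m, -, hm⟩ := Nat.exists_mul_mod_eq_of_coprime (C - 1) hCq.symm hC0
  obtain ⟨j, hj1, hj2⟩ := Nat.chineseRemainder hcop 1 m
  have hqj : q * j ≡ C - 1 [MOD C] := (hj2.mul_left q).trans hm
  have hqjC : C ∣ q * j + 1 := by
    have h1 : q * j + 1 ≡ C - 1 + 1 [MOD C] := hqj.add_right 1
    rw [Nat.sub_add_cancel (Nat.pos_of_ne_zero hC0)] at h1
    exact (Nat.modEq_zero_iff_dvd.1 (h1.trans (by simp [Nat.ModEq])))
  have hjcop : j.Coprime (4 * D * C) := by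
    refine Nat.Coprime.mul_right ?_ ?_
    · exact (Nat.coprime_of_mul_modEq_one 1 (by simpa using hj1))
    · have : (q * j).Coprime C :=
        (Nat.Coprime.coprime_dvd_right hqjC (by simp))
      exact this.coprime_mul_left
  obtain ⟨p, hpgt, hp, hpj⟩ := Nat.forall_exists_prime_gt_and_modEq (q + C + D)
    (mul_ne_zero (mul_ne_zero four_ne_zero hD.ne_zero) hC0) hjcop
  have hp1 : p ≡ 1 [MOD 4 * D] := (hpj.of_mul_right C).trans hj1
  have hp4 : p % 4 = 1 := hp1.of_mul_right D
  have hpD : p ≡ 1 [MOD D] := hp1.of_mul_left 4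
  have hpC : C ∣ q * p + 1 :=
    ((((hpj.of_mul_left (4 * D)).mul_left q).add_right 1).dvd_iff dvd_rfl).2 hqjC
  have hpodd : Odd p := by rw [Nat.odd_iff]; omega
  have : Fact p.Prime := ⟨hp⟩
  have hCp : C.Coprime p := (Nat.coprime_of_lt_prime hC0 (by omega) hp).symm
  have hqp : q.Coprime p := (Nat.coprime_of_lt_prime hq.ne_zero (by omega) hp).symm
  have hDp : D.Coprime p := (Nat.coprime_of_lt_prime hD.ne_zero (by omega) hp).symm
  -- `-D` is a square modulo `p`
  have hJD : J(-D | p) = 1 := by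
    rw [jacobiSym.neg _ hpodd, ZMod.χ₄_nat_one_mod_four hp4, one_mul,
      jacobiSym.quadratic_reciprocity_one_mod_four' hDodd hp4,
      jacobiSym.mod_left' (a₂ := 1) (by exact_mod_cast hpD), jacobiSym.one_left]
  -- `C` is a square modulo `p`
  have hJq : J(q | C) = 1 := by
    rcases hq.eq_two_or_odd' with rfl | hodd
    · rw [Nat.cast_ofNat, jacobiSym.at_two hCodd, ZMod.χ₈_nat_eq_if_mod_eight]
      have : C % 2 = 1 := by omega
      simp [hC, this]
    · rw [← jacobiSym.quadratic_reciprocity_one_mod_four (by omega) hodd,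
        jacobiSym.mod_left' (a₂ := h ^ 2) (Int.modEq_iff_dvd.2 hsq), jacobiSym.sq_one']
      have : IsCoprime (h ^ 2) (q : ℤ) := by
        obtain ⟨k, hk⟩ := hsq
        have h1 : h ^ 2 = C + q * k := by linarith
        rw [h1]
        exact (IsCoprime.add_mul_left_left (Nat.isCoprime_iff_coprime.2 hCq) k)
      exact Int.isCoprime_iff_gcd_eq_one.1 ((IsCoprime.pow_left_iff two_pos).1 this)
  have hJqp : J(q * p | C) = 1 := by
    rw [jacobiSym.mod_left' (a₂ := -1), jacobiSym.at_neg_one hCodd,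
      ZMod.χ₄_nat_one_mod_four (by omega)]
    refine Int.modEq_iff_dvd.2 ?_
    rw [← dvd_neg]
    refine (Int.natCast_dvd_natCast.2 hpC).trans (dvd_of_eq ?_)
    push_cast; ring
  have hJC : J(C | p) = 1 := by
    rw [jacobiSym.quadratic_reciprocity_one_mod_four (by omega) hpodd]
    rwa [jacobiSym.mul_left, hJq, one_mul] at hJqp
  have lift : ∀ a : ℤ, J(a | p) = 1 → ∃ s : ℤ, (p : ℤ) ∣ s ^ 2 - a := by
    intro a ha
    obtain ⟨y, hy⟩ := ZMod.isSquare_of_jacobiSym_eq_one ha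
    obtain ⟨s, rfl⟩ := ZMod.intCast_surjective y
    refine ⟨s, ?_⟩
    rw [← ZMod.intCast_eq_intCast_iff_dvd_sub, hy]
    push_cast; ring
  obtain ⟨r, hr⟩ := lift _ hJD
  obtain ⟨s, hs⟩ := lift _ hJC
  obtain ⟨x₁, y₁, z₁, hx₁, e₁⟩ := exists_sq_add_mul_sq_eq_mul_sq (a := p) (b := D) (r := r) (s := 1)
    hp.prime.not_isSquare hD.prime.not_isSquare hDp.symm (by simpa using hr) (by
      simpa using Int.modEq_iff_dvd.1 ((Int.natCast_modEq_iff).2 hpD))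
  obtain ⟨u, hu1, hu2⟩ : ∃ u : ℤ, (q : ℤ) ∣ u - h ∧ (p : ℤ) ∣ u - s := by
    obtain ⟨α, β, hαβ⟩ := Nat.isCoprime_iff_coprime.2 hqp
    refine ⟨h + (s - h) * (α * q), ⟨(s - h) * α, by ring⟩, ⟨(h - s) * β, ?_⟩⟩
    linear_combination (s - h) * hαβ
  have hqpsq : ¬ IsSquare (q * p) := by
    rintro ⟨t, ht⟩
    have hpt : p ∣ t := by
      have : p ∣ t * t := ht ▸ dvd_mul_left p q
      exact (hp.dvd_mul.1 this).elim id id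
    obtain ⟨v, rfl⟩ := hpt
    have h1 : q = p * (v * v) := by
      apply Nat.eq_of_mul_eq_mul_right hp.pos
      rw [ht]; ring
    have : p ∣ q := ⟨_, h1⟩
    have := Nat.le_of_dvd hq.pos this
    omega
  obtain ⟨x₂, y₂, z₂, hx₂, e₂⟩ := exists_sq_add_mul_sq_eq_mul_sq (a := C) (b := q * p)
    (r := 1) (s := u) hCs hqpsq (hCq.mul_right hCp)
    (by
      refine (Int.natCast_dvd_natCast.2 hpC).trans (dvd_of_eq ?_)
      push_cast; ring)
    (by
      push_cast
      refine (Nat.isCoprime_iff_coprime.2 hqp).mul_dvd ?_ ?_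
      · have : u ^ 2 - C = (u - h) * (u + h) + (h ^ 2 - C) := by ring
        rw [this]
        exact dvd_add (hu1.mul_right _) hsq
      · have : u ^ 2 - C = (u - s) * (u + s) + (s ^ 2 - C) := by ring
        rw [this]
        exact dvd_add (hu2.mul_right _) hs)
  have hx₁' : (x₁ : ℚ) ≠ 0 := by exact_mod_cast hx₁
  have hx₂' : (x₂ : ℚ) ≠ 0 := by exact_mod_cast hx₂
  have e₁' : (z₁ : ℚ) ^ 2 + D * y₁ ^ 2 = p * x₁ ^ 2 := by exact_mod_cast e₁
  have e₂' : (z₂ : ℚ) ^ 2 + q * p * y₂ ^ 2 = C * x₂ ^ 2 := by exact_mod_cast e₂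
  refine ⟨z₂ / x₂, y₂ * z₁ / (x₂ * x₁), y₂ * y₁ / (x₂ * x₁), ?_⟩
  field_simp
  linear_combination x₁ ^ 2 * e₂' + q * y₂ ^ 2 * e₁'

/-- If `t² + t + e` has no root modulo `q`, the form `a² + ab + eb²` is anisotropic modulo `q`. -/
theorem dvd_and_dvd_of_dvd_norm {q : ℕ} [Fact q.Prime] {e : ℤ}
    (he : ∀ t : ZMod q, t ^ 2 + t + e ≠ 0) {a b : ℤ}
    (h : (q : ℤ) ∣ a ^ 2 + a * b + e * b ^ 2) : (q : ℤ) ∣ a ∧ (q : ℤ) ∣ b := by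
  rw [← ZMod.intCast_zmod_eq_zero_iff_dvd] at h
  push_cast at h
  have hb : (b : ZMod q) = 0 := by
    by_contra hb
    apply he (a / b)
    field_simp
    linear_combination h
  rw [hb] at h
  have ha : (a : ZMod q) = 0 := by simpa using h
  exact ⟨(ZMod.intCast_zmod_eq_zero_iff_dvd _ _).1 ha, (ZMod.intCast_zmod_eq_zero_iff_dvd _ _).1 hb⟩

theorem exists_mul_eq_mul_of_norm_add_norm_eq_sq {q : ℕ} [hq : Fact q.Prime] {e : ℤ}
    (he : ∀ t : ZMod q, t ^ 2 + t + e ≠ 0) (n : ℕ) :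
    ∀ {a b c d t : ℤ}, t.natAbs = n → t ≠ 0 →
      (a ^ 2 + a * b + e * b ^ 2) + q * (c ^ 2 + c * d + e * d ^ 2) = t ^ 2 →
      ∃ r s : ℤ, ¬ (q : ℤ) ∣ s ∧ r * t = s * b := by
  induction n using Nat.strong_induction_on with
  | _ n ih =>
    intro a b c d t htn ht h
    by_cases hqt : (q : ℤ) ∣ t
    · have hq0 : (q : ℤ) ≠ 0 := by exact_mod_cast hq.out.ne_zero
      obtain ⟨t, rfl⟩ := hqt
      obtain ⟨⟨a, rfl⟩, b, rfl⟩ := dvd_and_dvd_of_dvd_norm he (a := a) (b := b)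
        ⟨q * t ^ 2 - (c ^ 2 + c * d + e * d ^ 2), by linear_combination h⟩
      obtain ⟨⟨c, rfl⟩, d, rfl⟩ := dvd_and_dvd_of_dvd_norm he (a := c) (b := d)
        ⟨t ^ 2 - (a ^ 2 + a * b + e * b ^ 2), by
          apply mul_left_cancel₀ hq0
          linear_combination h⟩
      have ht' : t ≠ 0 := right_ne_zero_of_mul ht
      obtain ⟨r, s, hs, hrs⟩ := ih t.natAbs (by
          rw [← htn, Int.natAbs_mul, Int.natAbs_natCast]
          exact lt_mul_of_one_lt_left (Int.natAbs_pos.2 ht') hq.out.one_lt)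
        rfl ht' (a := a) (b := b) (c := c) (d := d) (by
          apply mul_left_cancel₀ (pow_ne_zero 2 hq0)
          linear_combination h)
      exact ⟨r, s, hs, by linear_combination q * hrs⟩
    · exact ⟨b, t, hqt, mul_comm _ _⟩

/-- If `t² + t + e` has no root modulo `q`, then in any rational solution of
`N(a, b) + q N(c, d) = 1` with `N(a, b) = a² + ab + eb²`, the number `b` is `q`-integral. -/
theorem exists_int_div_of_norm_add_norm_eq_one {q : ℕ} [hq : Fact q.Prime] {e : ℤ}
    (he : ∀ t : ZMod q, t ^ 2 + t + e ≠ 0) {a b c d : ℚ}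
    (h : (a ^ 2 + a * b + e * b ^ 2) + q * (c ^ 2 + c * d + e * d ^ 2) = 1) :
    ∃ r s : ℤ, ¬ (q : ℤ) ∣ s ∧ (r : ℚ) = s * b := by
  have hT : (a.den * b.den * c.den * d.den : ℤ) ≠ 0 := by positivity
  obtain ⟨r, s, hs, hrs⟩ := exists_mul_eq_mul_of_norm_add_norm_eq_sq he _
    (a := a.num * b.den * c.den * d.den) (b := a.den * b.num * c.den * d.den)
    (c := a.den * b.den * c.num * d.den) (d := a.den * b.den * c.den * d.num)
    (t := a.den * b.den * c.den * d.den) rfl hT (by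
      have ha : (a.num : ℚ) = a * a.den := (Rat.mul_den_eq_num a).symm
      have hb : (b.num : ℚ) = b * b.den := (Rat.mul_den_eq_num b).symm
      have hc : (c.num : ℚ) = c * c.den := (Rat.mul_den_eq_num c).symm
      have hd : (d.num : ℚ) = d * d.den := (Rat.mul_den_eq_num d).symm
      rw [← Int.cast_inj (α := ℚ)]
      push_cast
      rw [ha, hb, hc, hd]
      linear_combination ((a.den : ℚ) * b.den * c.den * d.den) ^ 2 * h)
  refine ⟨r, s, hs, ?_⟩
  have hT' : (a.den * b.den * c.den * d.den : ℚ) ≠ 0 := by exact_mod_cast hT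
  apply mul_right_cancel₀ hT'
  have hb : (b.num : ℚ) = b * b.den := (Rat.mul_den_eq_num b).symm
  have hrs' : (r : ℚ) * (a.den * b.den * c.den * d.den) = s * (a.den * b.num * c.den * d.den) := by
    exact_mod_cast hrs
  rw [hrs', hb]; ring

/-- If the equation below is solvable in `a, b, w`, then `x` is `q`-integral. -/
theorem not_dvd_den_of_representation {q D k c : ℕ} [hq : Fact q.Prime] {e : ℤ}
    (he : ∀ t : ZMod q, t ^ 2 + t + e ≠ 0) (hD : (D : ℤ) + 1 = 4 * e) (hk : Even k) (hk3 : 3 ≤ k)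
    (hc : q ^ 6 ∣ c) {x a b w : ℚ}
    (h : (1 + c * x ^ k + c * x ^ (2 * k)) ^ 2 =
      a ^ 2 + q * (b ^ 2 + D * w ^ 2) + D * (4 * q * x ^ (2 * k)) ^ 2) : ¬ (q : ℤ) ∣ x.den := by
  intro hqd
  have hX : 0 ≤ x ^ k := hk.pow_nonneg x
  have hX2 : x ^ (2 * k) = (x ^ k) ^ 2 := by rw [mul_comm, pow_mul]
  rw [hX2] at h
  have hH : 0 < 1 + c * x ^ k + c * (x ^ k) ^ 2 := by positivity
  have hDq : (D : ℚ) = 4 * e - 1 := by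
    have : (D : ℚ) + 1 = 4 * e := by exact_mod_cast hD
    linarith
  set H : ℚ := 1 + c * x ^ k + c * (x ^ k) ^ 2 with hHdef
  set X : ℚ := x ^ k with hXdef
  obtain ⟨r, s, hs, hrs⟩ := exists_int_div_of_norm_add_norm_eq_one he
    (a := a / H - 4 * q * X ^ 2 / H) (b := 8 * q * X ^ 2 / H) (c := b / H - w / H)
    (d := 2 * w / H) (by
      rw [hDq] at h
      field_simp
      linear_combination -h)
  have hxn : x ^ k * (x.den : ℚ) ^ k = (x.num : ℚ) ^ k := by
    rw [← mul_pow, Rat.mul_den_eq_num]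
  have hint : r * (((x.den : ℤ) ^ k) ^ 2 + c * (x.den : ℤ) ^ k * x.num ^ k + c * (x.num ^ k) ^ 2)
      = s * (8 * q * (x.num ^ k) ^ 2) := by
    have hrs' : r * H = s * (8 * q * X ^ 2) := by
      rw [hrs]; field_simp
    have : (r : ℚ) * (((x.den : ℚ) ^ k) ^ 2 + c * (x.den : ℚ) ^ k * (x.num : ℚ) ^ k
        + c * ((x.num : ℚ) ^ k) ^ 2) = s * (8 * q * ((x.num : ℚ) ^ k) ^ 2) := by
      rw [← hxn, ← hXdef]
      rw [hHdef] at hrs'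
      linear_combination ((x.den : ℚ) ^ k) ^ 2 * hrs'
    exact_mod_cast this
  have hcz : (q : ℤ) ^ 6 ∣ c := by exact_mod_cast hc
  have hu : (q : ℤ) ^ 6 ∣ ((x.den : ℤ) ^ k) ^ 2 := by
    rw [← pow_mul]
    exact (pow_dvd_pow _ (by omega)).trans (pow_dvd_pow_of_dvd hqd _)
  have hdvd : (q : ℤ) ^ 6 ∣ s * (8 * q * (x.num ^ k) ^ 2) := by
    rw [← hint]
    exact (dvd_add (dvd_add hu ((hcz.mul_right _).mul_right _)) (hcz.mul_right _)).mul_left _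
  have hqp : Prime (q : ℤ) := Nat.prime_iff_prime_int.1 hq.out
  have hcopn : IsCoprime (q : ℤ) x.num := by
    rw [Int.isCoprime_iff_gcd_eq_one, Int.gcd_comm]
    exact Nat.Coprime.coprime_dvd_right (by simpa using Int.natCast_dvd_natCast.1 hqd) x.reduced
  have hcops : IsCoprime (q : ℤ) s := (Prime.coprime_iff_not_dvd hqp).2 hs
  have h5 : (q : ℤ) ^ 5 ∣ 8 := by
    have h1 : (q : ℤ) * q ^ 5 ∣ q * (8 * (s * (x.num ^ k) ^ 2)) := by
      convert hdvd using 1 <;> ring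
    have h2 := (mul_dvd_mul_iff_left hqp.ne_zero).1 h1
    exact (IsCoprime.mul_right hcops hcopn.pow_right.pow_right).pow_left.dvd_of_dvd_mul_right h2
  have h6 := Int.le_of_dvd (by norm_num) h5
  have h7 : (2 : ℤ) ^ 5 ≤ (q : ℤ) ^ 5 :=
    pow_le_pow_left₀ (by norm_num) (by exact_mod_cast hq.out.two_le) 5
  omega

/-- Every `q`-integral rational `x` satisfies the equation of `not_dvd_den_of_representation`. -/
theorem exists_representation_of_not_dvd_den {q D : ℕ} (hq : q.Prime) (hD : D.Prime)
    (hD4 : D % 4 = 3) (hD3 : 3 < D) (hqD : q < D) {x : ℚ} (hx : ¬ q ∣ x.den) :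
    ∃ a b w : ℚ,
      (1 + (q ^ (6 * (D - 1)) : ℕ) * x ^ (D - 1) + (q ^ (6 * (D - 1)) : ℕ) * x ^ (2 * (D - 1))) ^ 2
      = a ^ 2 + q * (b ^ 2 + D * w ^ 2) + D * (4 * q * x ^ (2 * (D - 1))) ^ 2 := by
  have : Fact D.Prime := ⟨hD⟩
  set c : ℕ := q ^ (6 * (D - 1)) with hc
  have hkeven : Even (D - 1) := by rw [Nat.even_iff]; omega
  set u : ℕ := x.den ^ (D - 1) with hu
  set v : ℕ := x.num.natAbs ^ (D - 1) with hv
  have hu0 : 0 < u := pow_pos x.den_pos _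
  have hxuv : x ^ (D - 1) * u = v := by
    rw [hu, hv]
    push_cast
    rw [← mul_pow, Rat.mul_den_eq_num, ← Int.cast_natCast, Int.natCast_natAbs, Int.cast_abs,
      hkeven.pow_abs]
  have huv : u.Coprime v := (x.reduced.symm).pow _ _
  have hqc : q ∣ c := dvd_pow_self _ (by omega)
  have hqu : ¬ q ∣ u := fun h => hx (hq.dvd_of_dvd_pow h)
  have hc4 : 4 * q * D ≤ c := by
    obtain ⟨j, hj⟩ : ∃ j, 6 * (D - 1) = 1 + (2 + D + j) := ⟨5 * D - 9, by omega⟩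
    rw [hc, hj, pow_add, pow_add, pow_add, pow_one]
    have h1 : 2 ^ 2 ≤ q ^ 2 := Nat.pow_le_pow_left hq.two_le 2
    have h2 : D ≤ q ^ D := (Nat.lt_pow_self hq.one_lt).le
    have h3 : 1 ≤ q ^ j := Nat.one_le_pow _ _ hq.pos
    calc 4 * q * D = q * (2 ^ 2 * D * 1) := by ring
      _ ≤ _ := Nat.mul_le_mul_left _ (Nat.mul_le_mul (Nat.mul_le_mul h1 h2) h3)
  set h : ℕ := u ^ 2 + c * u * v + c * v ^ 2 with hh
  have hlt : D * (4 * q * v ^ 2) ^ 2 < h ^ 2 := by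
    have h1 : 4 * q * D * v ^ 2 < h := by
      have := Nat.mul_le_mul_right (v ^ 2) hc4
      have := pow_pos hu0 2
      rw [hh]
      have := Nat.zero_le (c * u * v)
      omega
    calc D * (4 * q * v ^ 2) ^ 2 ≤ (D * D) * (4 * q * v ^ 2) ^ 2 :=
          Nat.mul_le_mul_right _ (Nat.le_mul_self D)
      _ = (4 * q * D * v ^ 2) ^ 2 := by ring
      _ < h ^ 2 := Nat.pow_lt_pow_left h1 two_ne_zero
  obtain ⟨C, hC⟩ := Nat.exists_eq_add_of_le hlt.le
  have hqh : ¬ q ∣ h := by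
    intro hdvd
    have h1 : q ∣ c * u * v + c * v ^ 2 :=
      dvd_add ((hqc.mul_right _).mul_right _) (hqc.mul_right _)
    have h2 : q ∣ u ^ 2 := (Nat.dvd_add_left h1).1 (by rwa [hh, add_assoc] at hdvd)
    exact hqu (hq.dvd_of_dvd_pow h2)
  have hhodd : h % 2 = 1 := by
    rcases hq.eq_two_or_odd with rfl | hodd
    · omega
    · have hcodd : c % 2 = 1 := Nat.odd_iff.1 ((Nat.odd_iff.2 hodd).pow)
      have h2 : ¬ (2 ∣ u ∧ 2 ∣ v) := fun ⟨h1, h2⟩ => by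
        have := Nat.dvd_gcd h1 h2
        rw [huv] at this
        omega
      have hu2 := Nat.mod_two_eq_zero_or_one u
      have hv2 := Nat.mod_two_eq_zero_or_one v
      rw [hh]
      rcases hu2 with hu2 | hu2 <;> rcases hv2 with hv2 | hv2 <;>
        simp [Nat.add_mod, Nat.mul_mod, Nat.pow_mod, hu2, hv2, hcodd]
      omega
  have hDh : ¬ D ∣ h := by
    have hqD0 : (q : ZMod D) ≠ 0 := by
      rw [Ne, ZMod.natCast_eq_zero_iff]
      exact Nat.not_dvd_of_pos_of_lt hq.pos hqD
    have hc1 : (c : ZMod D) = 1 := by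
      rw [hc, mul_comm 6, pow_mul]
      push_cast
      rw [ZMod.pow_card_sub_one_eq_one hqD0, one_pow]
    have hv01 : (v : ZMod D) = 0 ∨ (v : ZMod D) = 1 := by
      by_cases h0 : (x.num.natAbs : ZMod D) = 0
      · left
        rw [hv, Nat.cast_pow, h0, zero_pow (by omega)]
      · right
        rw [hv, Nat.cast_pow, ZMod.pow_card_sub_one_eq_one h0]
    have hu01 : (u : ZMod D) = 0 ∨ (u : ZMod D) = 1 := by
      by_cases h0 : (x.den : ZMod D) = 0
      · left
        rw [hu, Nat.cast_pow, h0, zero_pow (by omega)]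
      · right
        rw [hu, Nat.cast_pow, ZMod.pow_card_sub_one_eq_one h0]
    have huv0 : ¬ ((u : ZMod D) = 0 ∧ (v : ZMod D) = 0) := by
      rintro ⟨h1, h2⟩
      rw [ZMod.natCast_eq_zero_iff] at h1 h2
      exact hD.one_lt.ne' (Nat.dvd_one.1 (huv ▸ Nat.dvd_gcd h1 h2))
    have h3 : (3 : ZMod D) ≠ 0 := by
      have : ((3 : ℕ) : ZMod D) ≠ 0 := by
        rw [Ne, ZMod.natCast_eq_zero_iff]
        exact Nat.not_dvd_of_pos_of_lt (by norm_num) hD3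
      exact_mod_cast this
    rw [← ZMod.natCast_eq_zero_iff, hh]
    push_cast
    rw [hc1]
    rcases hu01 with h1 | h1 <;> rcases hv01 with h2 | h2
    · exact absurd ⟨h1, h2⟩ huv0
    · simp [h1, h2]
    · simp [h1, h2]
    · rw [h1, h2]
      norm_num
      exact h3
  have hC8 : C % 8 = 1 := by
    have h1 : h ^ 2 % 8 = 1 := by
      have : h % 8 = 1 ∨ h % 8 = 3 ∨ h % 8 = 5 ∨ h % 8 = 7 := by omega
      rcases this with h | h | h | h <;> simp [Nat.pow_mod, h]
    have h2 : D * (4 * q * v ^ 2) ^ 2 = 8 * (2 * D * q ^ 2 * v ^ 4) := by ring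
    omega
  have hCq : C.Coprime q := by
    rw [Nat.coprime_comm, hq.coprime_iff_not_dvd]
    intro hdvd
    refine hqh (hq.dvd_of_dvd_pow (n := 2) (hC ▸ dvd_add ?_ hdvd))
    exact ⟨D * 16 * q * v ^ 4, by ring⟩
  have hCD : C.Coprime D := by
    rw [Nat.coprime_comm, hD.coprime_iff_not_dvd]
    intro hdvd
    exact hDh (hD.dvd_of_dvd_pow (n := 2) (hC ▸ dvd_add (dvd_mul_right _ _) hdvd))
  obtain ⟨a, b, w, habw⟩ := exists_rat_sq_add_mul_norm hq hD hD4 hC8 hCq hCD (h := h) (by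
    have : (h : ℤ) ^ 2 = D * (4 * q * v ^ 2) ^ 2 + C := by exact_mod_cast hC
    exact ⟨D * 16 * q * v ^ 4, by linear_combination this⟩)
  have hu' : (u : ℚ) ≠ 0 := by exact_mod_cast hu0.ne'
  have hC' : (h : ℚ) ^ 2 = D * (4 * q * v ^ 2) ^ 2 + C := by exact_mod_cast hC
  have hh' : (h : ℚ) = u ^ 2 + c * u * v + c * v ^ 2 := by exact_mod_cast hh
  refine ⟨a / u ^ 2, b / u ^ 2, w / u ^ 2, ?_⟩
  have hX : x ^ (D - 1) = v / u := by rw [← hxuv]; field_simp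
  rw [mul_comm 2 (D - 1), pow_mul, hX]
  rw [hh', ← habw] at hC'
  field_simp
  linear_combination hC'

/-- There are arbitrarily large primes `D = 4e - 1` such that `t² + t + e` has no root modulo `q`. -/
theorem exists_prime_norm_form (q : ℕ) [hq : Fact q.Prime] (N : ℕ) :
    ∃ (D : ℕ) (e : ℤ), N < D ∧ D.Prime ∧ (D : ℤ) + 1 = 4 * e ∧
      ∀ t : ZMod q, t ^ 2 + t + e ≠ 0 := by
  obtain ⟨e₀, he₀⟩ : ∃ e₀ : ZMod q, ∀ t : ZMod q, t ^ 2 + t + e₀ ≠ 0 := by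
    have hinj : ¬ Function.Injective fun t : ZMod q => -(t ^ 2 + t) := by
      intro hinj
      have : (0 : ZMod q) = -1 := hinj (by ring)
      simp at this
    rw [Finite.injective_iff_surjective] at hinj
    unfold Function.Surjective at hinj
    push Not at hinj
    obtain ⟨e₀, he₀⟩ := hinj
    exact ⟨e₀, fun t ht => he₀ t (by linear_combination -ht)⟩
  obtain ⟨e₁, rfl⟩ := ZMod.intCast_surjective e₀
  have hcop : IsCoprime (4 * e₁ - 1) ((4 * q : ℕ) : ℤ) := by
    push_cast
    refine IsCoprime.mul_right ⟨-1, e₁, by ring⟩ ?_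
    rw [isCoprime_comm, Prime.coprime_iff_not_dvd (Nat.prime_iff_prime_int.1 hq.out)]
    intro hdvd
    rw [← ZMod.intCast_zmod_eq_zero_iff_dvd] at hdvd
    push_cast at hdvd
    have h2 : (2 : ZMod q) ≠ 0 := by
      intro h2
      have : (1 : ZMod q) = 0 := by linear_combination 2 * e₁ * h2 - hdvd
      exact one_ne_zero this
    apply he₀ (-1 / 2)
    field_simp
    linear_combination hdvd
  obtain ⟨D, hN, hD, hmod⟩ := Nat.forall_exists_prime_gt_and_zmodEq N
    (mul_ne_zero four_ne_zero hq.out.ne_zero) hcop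
  obtain ⟨j, hj⟩ := hmod.symm.dvd
  push_cast at hj
  refine ⟨D, e₁ + q * j, hN, hD, by linear_combination hj, ?_⟩
  simpa using he₀

/-- (Julia Robinson) For every prime `q`, the set
`Int_q = {x ∈ ℚ : x = a/b, a, b ∈ ℤ, q ∤ b}` of rationals whose (reduced) denominator is
not divisible by `q` is Diophantine over `ℚ`. -/
theorem int_q_diophantine_over_Q (q : ℕ) (hq : q.Prime) :
    IsDiophantine ℚ (Fin 1)
      {t | ∃ a b : ℤ, ¬ (q : ℤ) ∣ b ∧ t 0 = (a : ℚ) / (b : ℚ)} := by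
  have : Fact q.Prime := ⟨hq⟩
  obtain ⟨D, e, hDq, hD, hDe, he⟩ := exists_prime_norm_form q (q + 3)
  have hD4 : D % 4 = 3 := by omega
  let k := D - 1
  let c : ℚ := (q ^ (6 * (D - 1)) : ℕ)
  let T : MvPolynomial (Fin 1 ⊕ Fin 3) ℚ := .X (.inl 0)
  let Y : Fin 3 → MvPolynomial (Fin 1 ⊕ Fin 3) ℚ := fun i => .X (.inr i)
  refine ⟨3, (1 + .C c * T ^ k + .C c * T ^ (2 * k)) ^ 2 -
    (Y 0 ^ 2 + .C (q : ℚ) * (Y 1 ^ 2 + .C (D : ℚ) * Y 2 ^ 2) +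
      .C (D : ℚ) * (4 * .C (q : ℚ) * T ^ (2 * k)) ^ 2), fun t => ?_⟩
  have hev : ∀ y : Fin 3 → ℚ, MvPolynomial.eval (Sum.elim t y) ((1 + .C c * T ^ k +
      .C c * T ^ (2 * k)) ^ 2 - (Y 0 ^ 2 + .C (q : ℚ) * (Y 1 ^ 2 + .C (D : ℚ) * Y 2 ^ 2) +
      .C (D : ℚ) * (4 * .C (q : ℚ) * T ^ (2 * k)) ^ 2)) = 0 ↔
      (1 + c * t 0 ^ k + c * t 0 ^ (2 * k)) ^ 2 =
        y 0 ^ 2 + q * (y 1 ^ 2 + D * y 2 ^ 2) + D * (4 * q * t 0 ^ (2 * k)) ^ 2 := by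
    intro y
    simp [T, Y, sub_eq_zero]
  simp only [hev, Set.mem_ofPred_eq]
  constructor
  · rintro ⟨a, b, hb, hab⟩
    have hden : ¬ q ∣ (t 0).den := by
      intro h
      apply hb
      have := Rat.den_dvd a b
      rw [Rat.divInt_eq_div, ← hab] at this
      exact (Int.natCast_dvd_natCast.2 h).trans this
    obtain ⟨x, y, z, hxyz⟩ :=
      exists_representation_of_not_dvd_den hq hD hD4 (by omega) (by omega) hden
    exact ⟨![x, y, z], hxyz⟩
  · rintro ⟨y, hy⟩
    refine ⟨(t 0).num, (t 0).den, ?_, by simp [Rat.num_div_den]⟩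
    exact not_dvd_den_of_representation he hDe (by rw [Nat.even_iff]; omega) (by omega)
      (pow_dvd_pow _ (by omega)) hy
end
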